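/- For every η > 0 there exist ε₁ > 0 and a constant C > 0, independent of ε and n, such that for ε ∈ (0,ε₁) every solution as in the hypotheses satisfies √ε·(‖Z^{1/2}∂_yŴ‖_{L²} + |ñ|·‖Z^{1/2}Ŵ‖_{L²}) ≤ C·|log ε|^{1/2+η/6}·(|ñ|^{-1/2}‖Z^{1/2}R‖_{L²} + |ñ|^{1/2}‖Z^{1/2}Ŵ‖_{L²}) + C·ε^{1/4}·(‖Ŵ‖_{L²} + ‖Ŵ‖_{L²}^{1/2}‖R‖_{L²}^{1/2}). -/

import Mathlib

open MeasureTheory Set Filter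

noncomputable section

/-- Squared L² integral on the half line `(0,∞)`. -/
def nsq (f : ℝ → ℂ) : ℝ := ∫ y in Set.Ioi (0:ℝ), ‖f y‖ ^ 2

/-- L² norm of a quadruple of functions on `(0,∞)`. -/
def nrm4 (a b c d : ℝ → ℂ) : ℝ := Real.sqrt (nsq a + nsq b + nsq c + nsq d)

/-- Membership in `L²((0,∞))` (square integrability). -/
def ML2 (f : ℝ → ℂ) : Prop := MeasureTheory.IntegrableOn (fun y => ‖f y‖ ^ 2) (Set.Ioi 0)

/-- Multiplication by the square root of a weight. -/
def wt (Z : ℝ → ℝ) (f : ℝ → ℂ) : ℝ → ℂ := fun y => (Real.sqrt (Z y) : ℂ) * f y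

lemma cs_int {α : Type*} [MeasurableSpace α] {ν : Measure α} {f g : α → ℝ}
    (hf0 : ∀ᵐ x ∂ν, 0 ≤ f x) (hg0 : ∀ᵐ x ∂ν, 0 ≤ g x) (hf : MemLp f 2 ν) (hg : MemLp g 2 ν) :
    ∫ x, f x * g x ∂ν ≤ Real.sqrt (∫ x, f x ^ 2 ∂ν) * Real.sqrt (∫ x, g x ^ 2 ∂ν) := by
  have h := integral_mul_le_Lp_mul_Lq_of_nonneg (μ := ν) Real.HolderConjugate.two_two hf0 hg0
    (by simpa using hf) (by simpa using hg)
  simpa [Real.sqrt_eq_rpow] using h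

/-- One sided fundamental theorem on the half line. -/
lemma flux_le {Φ Φ' D B : ℝ → ℝ} (hc : ContinuousOn Φ (Ici 0))
    (hd : ∀ y, 0 < y → HasDerivAt Φ (Φ' y) y) (h0 : Φ 0 = 0)
    (hinf : Tendsto Φ atTop (nhds 0))
    (hD : IntegrableOn D (Ioi 0)) (hB : IntegrableOn B (Ioi 0))
    (hle : ∀ y, 0 < y → D y - B y ≤ Φ' y) :
    ∫ y in Ioi (0:ℝ), D y ≤ ∫ y in Ioi (0:ℝ), B y := by
  have hI : IntegrableOn (fun y => B y - D y) (Ioi 0) := hB.sub hD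
  have h1 : ∀ T : ℝ, 0 ≤ T → (-Φ T) ≤ ∫ y in (0:ℝ)..T, (B y - D y) := by
    intro T hT
    have := intervalIntegral.sub_le_integral_of_hasDeriv_right_of_le (g := fun y => -Φ y)
      (g' := fun y => -Φ' y) (φ := fun y => B y - D y) hT
      ((hc.mono Icc_subset_Ici_self).neg)
      (fun x hx => ((hd x hx.1).neg).hasDerivWithinAt)
      (by
        rw [integrableOn_Icc_iff_integrableOn_Ioc]
        exact hI.mono_set Ioc_subset_Ioi_self)
      (fun x hx => by have := hle x hx.1; linarith)
    simpa [h0] using this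
  have h2 := intervalIntegral_tendsto_integral_Ioi (0:ℝ) hI tendsto_id
  have h3 : (0:ℝ) ≤ ∫ y in Ioi (0:ℝ), (B y - D y) := by
    have h4 : Tendsto (fun T => -Φ T) atTop (nhds 0) := by simpa using hinf.neg
    refine le_of_tendsto_of_tendsto h4 h2 ?_
    filter_upwards [eventually_ge_atTop 0] with T hT using h1 T hT
  rw [integral_sub hB hD] at h3
  linarith

/-- real inner product of two complex numbers -/
def ip (a b : ℂ) : ℝ := a.re * b.re + a.im * b.im

lemma ip_le (a b : ℂ) : |ip a b| ≤ ‖a‖ * ‖b‖ := by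
  have h : ip a b = (a * (starRingEnd ℂ) b).re := by
    simp [ip]
  rw [h]
  refine (Complex.abs_re_le_norm _).trans ?_
  simp

lemma ip_self (a : ℂ) : ip a a = ‖a‖ ^ 2 := by
  rw [← Complex.normSq_eq_norm_sq, Complex.normSq_apply, ip]

lemma hasDerivAt_ip {f g : ℝ → ℂ} {f' g' : ℂ} {y : ℝ} (hf : HasDerivAt f f' y)
    (hg : HasDerivAt g g' y) :
    HasDerivAt (fun t => ip (f t) (g t)) (ip f' (g y) + ip (f y) g') y := by
  have a1 := Complex.reCLM.hasFDerivAt.comp_hasDerivAt y hf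
  have a2 := Complex.imCLM.hasFDerivAt.comp_hasDerivAt y hf
  have b1 := Complex.reCLM.hasFDerivAt.comp_hasDerivAt y hg
  have b2 := Complex.imCLM.hasFDerivAt.comp_hasDerivAt y hg
  have := (a1.mul b1).add (a2.mul b2)
  refine this.congr_deriv ?_
  simp only [ip, Function.comp, Complex.reCLM_apply, Complex.imCLM_apply]
  ring

lemma dslope_zero_norm {f : ℝ → ℂ} (h0 : f 0 = 0) {y : ℝ} (hy : 0 < y) :
    ‖dslope f 0 y‖ = ‖f y‖ / y := by
  rw [dslope_of_ne _ hy.ne', slope_def_module, h0]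
  simp [abs_of_pos hy]; ring

lemma dslope_cont {f f' : ℝ → ℂ} (hd : ∀ y, HasDerivAt f (f' y) y) :
    Continuous (dslope f 0) := by
  rw [continuous_iff_continuousAt]
  intro y
  by_cases h : y = 0
  · subst h
    exact continuousAt_dslope_same.2 (hd 0).differentiableAt
  · rw [continuousAt_dslope_of_ne h]
    exact (hd y).continuousAt

lemma hardy {f f' : ℝ → ℂ} (hd : ∀ y, HasDerivAt f (f' y) y) (hc : Continuous f')
    (h0 : f 0 = 0) (hL : ML2 f') :
    IntegrableOn (fun y => ‖dslope f 0 y‖ ^ 2) (Ioi 0) ∧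
      ∫ y in Ioi (0:ℝ), ‖dslope f 0 y‖ ^ 2 ≤ 4 * nsq f' := by
  have hcs := dslope_cont hd
  have key : ∀ T : ℝ, 0 ≤ T → ∫ y in (0:ℝ)..T, ‖dslope f 0 y‖ ^ 2 ≤ 4 * nsq f' := by
    intro T hT
    have h1 := intervalIntegral.sub_le_integral_of_hasDeriv_right_of_le
      (g := fun y => y * ‖dslope f 0 y‖ ^ 2)
      (g' := fun y => (2 * ip (f y) (f' y)) / y - ‖f y‖ ^ 2 / y ^ 2)
      (φ := fun y => 2 * ‖f' y‖ ^ 2 - 1 / 2 * ‖dslope f 0 y‖ ^ 2) hT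
      (by fun_prop)
      (fun x hx => by
        have hx0 : 0 < x := hx.1
        have e : (fun y => y * ‖dslope f 0 y‖ ^ 2) =ᶠ[nhds x] fun y => ip (f y) (f y) / y := by
          filter_upwards [eventually_gt_nhds hx0] with y hy
          rw [dslope_zero_norm h0 hy, ip_self]
          field_simp
        have d := ((hasDerivAt_ip (hd x) (hd x)).div (hasDerivAt_id x) hx0.ne')
        refine ((d.congr_of_eventuallyEq e).congr_deriv ?_).hasDerivWithinAt
        rw [ip_self]
        have : ip (f' x) (f x) = ip (f x) (f' x) := by simp [ip]; ring
        rw [this]; simp only [id]; field_simp; ring)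
      (Continuous.integrableOn_Icc (by fun_prop))
      (fun x hx => by
        have hx0 : 0 < x := hx.1
        rw [dslope_zero_norm h0 hx0]
        have := (abs_le.1 (ip_le (f x) (f' x))).2
        have h2 : (2 * ip (f x) (f' x)) / x ≤ 2 * (‖f x‖ / x) * ‖f' x‖ := by
          rw [div_le_iff₀ hx0]; field_simp; linarith
        have h3 : ‖f x‖ ^ 2 / x ^ 2 = (‖f x‖ / x) ^ 2 := by rw [div_pow]
        rw [h3]
        nlinarith [sq_nonneg ((‖f x‖ / x) - 2 * ‖f' x‖)])
    rw [intervalIntegral.integral_sub (Continuous.intervalIntegrable (by fun_prop) _ _)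
      (Continuous.intervalIntegrable (by fun_prop) _ _), intervalIntegral.integral_const_mul,
      intervalIntegral.integral_const_mul] at h1
    have h2 : 0 ≤ T * ‖dslope f 0 T‖ ^ 2 := by positivity
    have h3 : ∫ y in (0:ℝ)..T, ‖f' y‖ ^ 2 ≤ nsq f' := by
      rw [intervalIntegral.integral_of_le hT]
      exact setIntegral_mono_set hL (Eventually.of_forall fun y => by positivity)
        (Ioc_subset_Ioi_self.eventuallyLE)
    simp only [zero_mul] at h1
    linarith
  have hi : IntegrableOn (fun y => ‖dslope f 0 y‖ ^ 2) (Ioi 0) := by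
    refine integrableOn_Ioi_of_intervalIntegral_norm_bounded (4 * nsq f') 0
      (b := fun T : ℝ => T) (l := atTop) (fun T => ?_) tendsto_id ?_
    · exact Continuous.integrableOn_Ioc (by fun_prop)
    · filter_upwards [eventually_ge_atTop 0] with T hT
      simpa using key T hT
  refine ⟨hi, ?_⟩
  refine le_of_tendsto (intervalIntegral_tendsto_integral_Ioi (0:ℝ) hi tendsto_id) ?_
  filter_upwards [eventually_ge_atTop 0] with T hT using key T hT

/-- local L¹ bound with logarithmic loss -/
lemma loc_l1 {f : ℝ → ℝ} (hf0 : ∀ y, 0 ≤ f y) (hf : MemLp f 2 (volume.restrict (Ioi 0)))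
    {δ : ℝ} (hδ : 0 < δ) :
    (∫ y in Ioc (0:ℝ) 2, f y) ^ 2 ≤
      Real.log ((2 + δ) / δ) * ∫ y in Ioc (0:ℝ) 2, (y + δ) * f y ^ 2 := by
  have hf2 : MemLp f 2 (volume.restrict (Ioc 0 2)) :=
    hf.mono_measure (Measure.restrict_mono Ioc_subset_Ioi_self le_rfl)
  set ν := (volume.restrict (Ioc (0:ℝ) 2)) with hν
  have hpos : ∀ᵐ y ∂ν, 0 < y ∧ y ≤ 2 := by
    rw [hν]; filter_upwards [ae_restrict_mem measurableSet_Ioc] with y hy using hy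
  have ha : MemLp (fun y : ℝ => 1 / Real.sqrt (y + δ)) 2 ν := by
    refine MemLp.of_bound
      (by fun_prop : Measurable (fun y : ℝ => 1 / Real.sqrt (y + δ))).aestronglyMeasurable
      (1 / Real.sqrt δ) ?_
    filter_upwards [hpos] with y hy
    rw [Real.norm_of_nonneg (by positivity)]
    exact one_div_le_one_div_of_le (by positivity) (Real.sqrt_le_sqrt (by linarith [hy.1]))
  have hb : MemLp (fun y : ℝ => Real.sqrt (y + δ) * f y) 2 ν := by
    refine MemLp.of_le_mul (c := Real.sqrt (2 + δ)) hf2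
      ((by fun_prop : AEStronglyMeasurable (fun y : ℝ => Real.sqrt (y + δ)) ν).mul hf2.1) ?_
    filter_upwards [hpos] with y hy
    rw [norm_mul, Real.norm_of_nonneg (Real.sqrt_nonneg _)]
    gcongr; exact hy.2
  have cs := cs_int (Eventually.of_forall fun y => by positivity)
    (Eventually.of_forall fun y => mul_nonneg (Real.sqrt_nonneg _) (hf0 y)) ha hb
  have e1 : ∫ y, 1 / Real.sqrt (y + δ) * (Real.sqrt (y + δ) * f y) ∂ν = ∫ y, f y ∂ν := by
    refine integral_congr_ae ?_
    filter_upwards [hpos] with y hy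
    have : 0 < Real.sqrt (y + δ) := Real.sqrt_pos.2 (by linarith [hy.1])
    field_simp
  have e2 : ∫ y, (1 / Real.sqrt (y + δ)) ^ 2 ∂ν = Real.log ((2 + δ) / δ) := by
    have : ∫ y, (1 / Real.sqrt (y + δ)) ^ 2 ∂ν = ∫ y, 1 / (y + δ) ∂ν := by
      refine integral_congr_ae ?_
      filter_upwards [hpos] with y hy
      rw [div_pow, Real.sq_sqrt (by linarith [hy.1])]; simp
    rw [this, hν, ← intervalIntegral.integral_of_le (by norm_num),
      intervalIntegral.integral_comp_add_right (fun x => 1 / x) δ,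
      integral_one_div_of_pos (by linarith) (by linarith)]
    simp
  have e3 : ∫ y, (Real.sqrt (y + δ) * f y) ^ 2 ∂ν = ∫ y, (y + δ) * f y ^ 2 ∂ν := by
    refine integral_congr_ae ?_
    filter_upwards [hpos] with y hy
    rw [mul_pow, Real.sq_sqrt (by linarith [hy.1])]
  rw [e1, e2, e3] at cs
  have hl : 0 ≤ Real.log ((2 + δ) / δ) := Real.log_nonneg (by rw [le_div_iff₀ hδ]; linarith)
  have hr : 0 ≤ ∫ y, (y + δ) * f y ^ 2 ∂ν := by
    refine integral_nonneg_of_ae ?_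
    filter_upwards [hpos] with y hy
    have := hy.1
    positivity
  have hl0 : 0 ≤ ∫ y, f y ∂ν := integral_nonneg hf0
  calc (∫ y, f y ∂ν) ^ 2 ≤ (Real.sqrt (Real.log ((2 + δ) / δ)) *
        Real.sqrt (∫ y, (y + δ) * f y ^ 2 ∂ν)) ^ 2 := by gcongr
    _ = _ := by rw [mul_pow, Real.sq_sqrt hl, Real.sq_sqrt hr]

lemma pt_identity (n k me ke G G1 cu ζ ζ1 ζ2 : ℝ) (hk : k * n = 1)
    (u v h g u1 v1 h1 g1 u2 v2 h2 g2 p p1 E1 E2 E3 E4 R1 R2 R3 R4 : ℂ)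
    (e1 : Complex.I * (n:ℂ) * ((cu:ℂ) * u - (G:ℂ) * h) + E1 + Complex.I * (n:ℂ) * p
      - (me:ℂ) * (u2 - (n:ℂ)^2 * u) = R1)
    (e2 : Complex.I * (n:ℂ) * ((cu:ℂ) * v - (G:ℂ) * g) + E2 + p1
      - (me:ℂ) * (v2 - (n:ℂ)^2 * v) = R2)
    (e3 : -(Complex.I * (n:ℂ)) * u + E3 - (ke:ℂ) * (h2 - (n:ℂ)^2 * h) = R3)
    (e4 : -(Complex.I * (n:ℂ)) * v + E4 - (ke:ℂ) * (g2 - (n:ℂ)^2 * g) = R4)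
    (d : Complex.I * (n:ℂ) * u + v1 = 0) :
    me * (ζ1 * (ip u1 u + ip v1 v) + ζ * (ip u2 u + ip u1 u1 + (ip v2 v + ip v1 v1)))
      + ke * ((ζ1 * G + ζ * G1) * (ip h1 h + ip g1 g)
        + ζ * G * (ip h2 h + ip h1 h1 + (ip g2 g + ip g1 g1)))
      - (ζ1 * ip p v + ζ * (ip p1 v + ip p v1))
      + me * k * (ζ2 * ip (-Complex.I * u1) v
        + ζ1 * (ip (-Complex.I * u2) v + ip (-Complex.I * u1) v1))
    = ζ * (me * (ip u1 u1 + ip v1 v1 + n^2 * (ip u u + ip v v))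
          + ke * G * (ip h1 h1 + ip g1 g1 + n^2 * (ip h h + ip g g)))
      + (me * ζ1 * (2 * ip u1 u + ip v1 v) + ke * (ζ1 * G + ζ * G1) * (ip h1 h + ip g1 g)
        + ζ * (ip E1 u + ip E2 v - ip R1 u - ip R2 v)
        + ζ * G * (ip E3 h + ip E4 g - ip R3 h - ip R4 g)
        - ζ1 * k * ip (-Complex.I * (R1 - E1 - ((me * n^2 : ℝ) : ℂ) * u)) v
        + ζ1 * ip ((cu:ℂ) * u - (G:ℂ) * h) v + me * k * ζ2 * ip (-Complex.I * u1) v) := by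
  have e1r := congrArg Complex.re e1
  have e1i := congrArg Complex.im e1
  have e2r := congrArg Complex.re e2
  have e2i := congrArg Complex.im e2
  have e3r := congrArg Complex.re e3
  have e3i := congrArg Complex.im e3
  have e4r := congrArg Complex.re e4
  have e4i := congrArg Complex.im e4
  have dr := congrArg Complex.re d
  have di := congrArg Complex.im d
  simp [pow_two] at e1r e1i e2r e2i e3r e3i e4r e4i dr di
  simp [ip, pow_two]
  linear_combination (-ζ * u.re + ζ1 * k * v.im) * e1r + (-ζ * u.im - ζ1 * k * v.re) * e1i
    - ζ * v.re * e2r - ζ * v.im * e2i - ζ * G * h.re * e3r - ζ * G * h.im * e3i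
    - ζ * G * g.re * e4r - ζ * G * g.im * e4i
    + (-ζ * p.re + me * k * ζ1 * u1.im) * dr + (-ζ * p.im - me * k * ζ1 * u1.re) * di
    + (ζ1 * (p.re * v.re + p.im * v.im)
      + ζ1 * ((cu * u.re - G * h.re) * v.re + (cu * u.im - G * h.im) * v.im)
      + me * ζ1 * (u1.re * u.re + u1.im * u.im)) * hk

lemma ip_le' {a b : ℂ} {x y : ℝ} (ha : ‖a‖ ≤ x) (hb : ‖b‖ ≤ y) : |ip a b| ≤ x * y :=
  (ip_le a b).trans (mul_le_mul ha hb (norm_nonneg _) ((norm_nonneg _).trans ha))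

set_option maxHeartbeats 2000000 in
/-- lower bound of the derivative of the flux -/
lemma pt_lower (μ κ γ₀ K ε n k G G1 cu ζ ζ1 ζ2 W W1 r e : ℝ)
    (hμ : 0 < μ) (hκ : 0 < κ) (hγ₀ : 0 < γ₀) (hε : 0 < ε)
    (hk : |k| = |n|⁻¹) (hn : n ≠ 0) (hζ : 0 ≤ ζ) (hG : γ₀ ≤ G) (hGK : G ≤ K) (hcu : |cu| ≤ K)
    (u v h g u1 v1 h1 g1 E1 E2 E3 E4 R1 R2 R3 R4 : ℂ)
    (hu : ‖u‖ ≤ W) (hv : ‖v‖ ≤ W) (hh : ‖h‖ ≤ W) (hg : ‖g‖ ≤ W)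
    (hu1 : ‖u1‖ ≤ W1) (hv1 : ‖v1‖ ≤ W1) (hh1 : ‖h1‖ ≤ W1) (hg1 : ‖g1‖ ≤ W1)
    (hE1 : ‖E1‖ ≤ e) (hE2 : ‖E2‖ ≤ e) (hE3 : ‖E3‖ ≤ e) (hE4 : ‖E4‖ ≤ e)
    (hR1 : ‖R1‖ ≤ r) (hR2 : ‖R2‖ ≤ r) (hR3 : ‖R3‖ ≤ r) (hR4 : ‖R4‖ ≤ r)
    (hW : W ^ 2 = ‖u‖^2 + ‖v‖^2 + ‖h‖^2 + ‖g‖^2)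
    (hW1 : W1 ^ 2 = ‖u1‖^2 + ‖v1‖^2 + ‖h1‖^2 + ‖g1‖^2) :
    ζ * (min μ (κ * γ₀) * ε * (W1 ^ 2 + n ^ 2 * W ^ 2))
      - (|ζ1| * ((3 * μ + 2 * κ * K) * ε) * (W1 * W) + 2 * κ * ε * (ζ * |G1|) * (W1 * W)
        + (2 + 2 * K) * (ζ * (e * W)) + (2 + 2 * K) * (ζ * (r * W))
        + |ζ1| * (|n|⁻¹ * ((r + e + μ * ε * n ^ 2 * W) * ‖v‖)) + |ζ1| * (2 * K * (W * ‖v‖))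
        + μ * ε * (|n|⁻¹ * (|ζ2| * (W1 * ‖v‖))))
    ≤ ζ * (μ * ε * (ip u1 u1 + ip v1 v1 + n^2 * (ip u u + ip v v))
          + κ * ε * G * (ip h1 h1 + ip g1 g1 + n^2 * (ip h h + ip g g)))
      + (μ * ε * ζ1 * (2 * ip u1 u + ip v1 v) + κ * ε * (ζ1 * G + ζ * G1) * (ip h1 h + ip g1 g)
        + ζ * (ip E1 u + ip E2 v - ip R1 u - ip R2 v)
        + ζ * G * (ip E3 h + ip E4 g - ip R3 h - ip R4 g)
        - ζ1 * k * ip (-Complex.I * (R1 - E1 - ((μ * ε * n^2 : ℝ) : ℂ) * u)) v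
        + ζ1 * ip ((cu:ℂ) * u - (G:ℂ) * h) v + μ * ε * k * ζ2 * ip (-Complex.I * u1) v) := by
  have hW0 : 0 ≤ W := (norm_nonneg _).trans hu
  have hW10 : 0 ≤ W1 := (norm_nonneg _).trans hu1
  have hr0 : 0 ≤ r := (norm_nonneg _).trans hR1
  have he0 : 0 ≤ e := (norm_nonneg _).trans hE1
  have hG0 : 0 ≤ G := hγ₀.le.trans hG
  have hK0 : 0 ≤ K := hG0.trans hGK
  have hn0 : 0 < |n| := abs_pos.2 hn
  -- main term
  have main : ζ * (min μ (κ * γ₀) * ε * (W1 ^ 2 + n ^ 2 * W ^ 2)) ≤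
      ζ * (μ * ε * (ip u1 u1 + ip v1 v1 + n^2 * (ip u u + ip v v))
          + κ * ε * G * (ip h1 h1 + ip g1 g1 + n^2 * (ip h h + ip g g))) := by
    refine mul_le_mul_of_nonneg_left ?_ hζ
    simp only [ip_self]
    rw [hW, hW1]
    have a1 : min μ (κ * γ₀) ≤ μ := min_le_left _ _
    have a2 : min μ (κ * γ₀) ≤ κ * G := (min_le_right _ _).trans (by gcongr)
    have b1 : min μ (κ * γ₀) * (ε * (‖u1‖^2 + ‖v1‖^2 + n^2 * (‖u‖^2 + ‖v‖^2))) ≤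
        μ * (ε * (‖u1‖^2 + ‖v1‖^2 + n^2 * (‖u‖^2 + ‖v‖^2))) := by gcongr
    have b2 : min μ (κ * γ₀) * (ε * (‖h1‖^2 + ‖g1‖^2 + n^2 * (‖h‖^2 + ‖g‖^2))) ≤
        κ * G * (ε * (‖h1‖^2 + ‖g1‖^2 + n^2 * (‖h‖^2 + ‖g‖^2))) := by gcongr
    nlinarith [b1, b2]
  have t1 : |μ * ε * ζ1 * (2 * ip u1 u + ip v1 v)| ≤ |ζ1| * (3 * μ * ε) * (W1 * W) := by
    have x1 := ip_le' hu1 hu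
    have x2 := ip_le' hv1 hv
    have : |2 * ip u1 u + ip v1 v| ≤ 3 * (W1 * W) := by
      rw [abs_le] at *; constructor <;> linarith [x1.1, x1.2, x2.1, x2.2]
    rw [abs_mul, abs_mul, abs_of_pos (mul_pos hμ hε)]
    calc μ * ε * |ζ1| * |2 * ip u1 u + ip v1 v| ≤ μ * ε * |ζ1| * (3 * (W1 * W)) := by gcongr
      _ = _ := by ring
  have t2 : |κ * ε * (ζ1 * G + ζ * G1) * (ip h1 h + ip g1 g)| ≤
      |ζ1| * (2 * κ * K * ε) * (W1 * W) + 2 * κ * ε * (ζ * |G1|) * (W1 * W) := by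
    have x1 := ip_le' hh1 hh
    have x2 := ip_le' hg1 hg
    have y1 : |ip h1 h + ip g1 g| ≤ 2 * (W1 * W) := by
      rw [abs_le] at *; constructor <;> linarith [x1.1, x1.2, x2.1, x2.2]
    have y2 : |ζ1 * G + ζ * G1| ≤ |ζ1| * K + ζ * |G1| := by
      refine (abs_add_le _ _).trans ?_
      rw [abs_mul, abs_mul, abs_of_nonneg hG0, abs_of_nonneg hζ]
      gcongr
    rw [abs_mul, abs_mul, abs_of_pos (mul_pos hκ hε)]
    calc κ * ε * |ζ1 * G + ζ * G1| * |ip h1 h + ip g1 g|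
        ≤ κ * ε * (|ζ1| * K + ζ * |G1|) * (2 * (W1 * W)) := by gcongr
      _ = _ := by ring
  have t3 : |ζ * (ip E1 u + ip E2 v - ip R1 u - ip R2 v)| ≤
      2 * (ζ * (e * W)) + 2 * (ζ * (r * W)) := by
    have x1 := ip_le' hE1 hu
    have x2 := ip_le' hE2 hv
    have x3 := ip_le' hR1 hu
    have x4 := ip_le' hR2 hv
    have : |ip E1 u + ip E2 v - ip R1 u - ip R2 v| ≤ 2 * (e * W) + 2 * (r * W) := by
      rw [abs_le] at *
      constructor <;> linarith [x1.1, x1.2, x2.1, x2.2, x3.1, x3.2, x4.1, x4.2]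
    rw [abs_mul, abs_of_nonneg hζ]
    calc ζ * _ ≤ ζ * (2 * (e * W) + 2 * (r * W)) := by gcongr
      _ = _ := by ring
  have t4 : |ζ * G * (ip E3 h + ip E4 g - ip R3 h - ip R4 g)| ≤
      2 * K * (ζ * (e * W)) + 2 * K * (ζ * (r * W)) := by
    have x1 := ip_le' hE3 hh
    have x2 := ip_le' hE4 hg
    have x3 := ip_le' hR3 hh
    have x4 := ip_le' hR4 hg
    have : |ip E3 h + ip E4 g - ip R3 h - ip R4 g| ≤ 2 * (e * W) + 2 * (r * W) := by
      rw [abs_le] at *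
      constructor <;> linarith [x1.1, x1.2, x2.1, x2.2, x3.1, x3.2, x4.1, x4.2]
    rw [abs_mul, abs_mul, abs_of_nonneg hζ, abs_of_nonneg hG0]
    calc ζ * G * _ ≤ ζ * K * (2 * (e * W) + 2 * (r * W)) := by gcongr
      _ = _ := by ring
  have t5 : |ζ1 * k * ip (-Complex.I * (R1 - E1 - ((μ * ε * n^2 : ℝ) : ℂ) * u)) v| ≤
      |ζ1| * (|n|⁻¹ * ((r + e + μ * ε * n ^ 2 * W) * ‖v‖)) := by
    have x1 : ‖-Complex.I * (R1 - E1 - ((μ * ε * n^2 : ℝ) : ℂ) * u)‖ ≤ r + e + μ * ε * n ^ 2 * W := by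
      rw [norm_mul, norm_neg, Complex.norm_I, one_mul]
      refine (norm_sub_le _ _).trans (add_le_add ((norm_sub_le _ _).trans (add_le_add hR1 hE1)) ?_)
      rw [norm_mul, Complex.norm_real, Real.norm_of_nonneg (by positivity)]
      gcongr
    rw [abs_mul, abs_mul, hk, mul_assoc]
    gcongr
    exact ip_le' x1 le_rfl
  have t6 : |ζ1 * ip ((cu:ℂ) * u - (G:ℂ) * h) v| ≤ |ζ1| * (2 * K * (W * ‖v‖)) := by
    have x1 : ‖(cu:ℂ) * u - (G:ℂ) * h‖ ≤ 2 * K * W := by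
      refine (norm_sub_le _ _).trans ?_
      rw [norm_mul, norm_mul, Complex.norm_real, Complex.norm_real, Real.norm_eq_abs,
        Real.norm_of_nonneg hG0]
      have : |cu| * ‖u‖ ≤ K * W := by gcongr
      have : G * ‖h‖ ≤ K * W := by gcongr
      linarith
    rw [abs_mul]
    have := ip_le' x1 (le_refl ‖v‖)
    calc |ζ1| * _ ≤ |ζ1| * (2 * K * W * ‖v‖) := by gcongr
      _ = _ := by ring
  have t7 : |μ * ε * k * ζ2 * ip (-Complex.I * u1) v| ≤
      μ * ε * (|n|⁻¹ * (|ζ2| * (W1 * ‖v‖))) := by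
    have x1 : ‖-Complex.I * u1‖ ≤ W1 := by
      rw [norm_mul, norm_neg, Complex.norm_I, one_mul]; exact hu1
    have := ip_le' x1 (le_refl ‖v‖)
    rw [abs_mul, abs_mul, abs_mul, abs_of_pos (mul_pos hμ hε), hk]
    calc μ * ε * |n|⁻¹ * |ζ2| * _ ≤ μ * ε * |n|⁻¹ * |ζ2| * (W1 * ‖v‖) := by gcongr
      _ = _ := by ring
  have s1 := (abs_le.1 t1).1
  have s2 := (abs_le.1 t2).1
  have s3 := (abs_le.1 t3).1
  have s4 := (abs_le.1 t4).1
  have s5 := (abs_le.1 t5).2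
  have s6 := (abs_le.1 t6).1
  have s7 := (abs_le.1 t7).1
  linarith

/-- pointwise length of a quadruple -/
def w4 (a b c d : ℝ → ℂ) : ℝ → ℝ :=
  fun y => Real.sqrt (‖a y‖ ^ 2 + ‖b y‖ ^ 2 + ‖c y‖ ^ 2 + ‖d y‖ ^ 2)

lemma w4_nonneg (a b c d : ℝ → ℂ) (y : ℝ) : 0 ≤ w4 a b c d y := Real.sqrt_nonneg _

lemma w4_sq (a b c d : ℝ → ℂ) (y : ℝ) :
    w4 a b c d y ^ 2 = ‖a y‖ ^ 2 + ‖b y‖ ^ 2 + ‖c y‖ ^ 2 + ‖d y‖ ^ 2 :=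
  Real.sq_sqrt (by positivity)

lemma le_w4 (a b c d : ℝ → ℂ) (y : ℝ) :
    ‖a y‖ ≤ w4 a b c d y ∧ ‖b y‖ ≤ w4 a b c d y ∧ ‖c y‖ ≤ w4 a b c d y ∧ ‖d y‖ ≤ w4 a b c d y := by
  refine ⟨?_, ?_, ?_, ?_⟩ <;> refine Real.le_sqrt_of_sq_le ?_ <;>
    nlinarith [sq_nonneg ‖a y‖, sq_nonneg ‖b y‖, sq_nonneg ‖c y‖, sq_nonneg ‖d y‖]

/-- The simplified system used in the proof. -/
structure Core (μ κ γ₀ K ε n : ℝ) (cu G G1 e q : ℝ → ℝ)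
    (u v h g u1 v1 h1 g1 u2 v2 h2 g2 p p1 E1 E2 E3 E4 R1 R2 R3 R4 : ℝ → ℂ) : Prop where
  hμ : 0 < μ
  hκ : 0 < κ
  hγ₀ : 0 < γ₀
  hK : 1 ≤ K
  hε : 0 < ε
  hn : n ≠ 0
  du : ∀ y, HasDerivAt u (u1 y) y
  dv : ∀ y, HasDerivAt v (v1 y) y
  dh : ∀ y, HasDerivAt h (h1 y) y
  dg : ∀ y, HasDerivAt g (g1 y) y
  du1 : ∀ y, HasDerivAt u1 (u2 y) y
  dv1 : ∀ y, HasDerivAt v1 (v2 y) y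
  dh1 : ∀ y, HasDerivAt h1 (h2 y) y
  dg1 : ∀ y, HasDerivAt g1 (g2 y) y
  dp : ∀ y, HasDerivAt p (p1 y) y
  dG : ∀ y, HasDerivAt G (G1 y) y
  bcu : ∀ y, 0 < y → |cu y| ≤ K
  bG : ∀ y, 0 ≤ y → γ₀ ≤ G y ∧ G y ≤ K
  bG1 : ∀ y, 0 < y → |G1 y| * Real.sqrt ε ≤ K ∧ y * |G1 y| ≤ K
  bE : ∀ y, 0 < y → ‖E1 y‖ ≤ e y ∧ ‖E2 y‖ ≤ e y ∧ ‖E3 y‖ ≤ e y ∧ ‖E4 y‖ ≤ e y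
  be : ∀ y, 0 < y → e y ≤ K * ((Real.sqrt ε * |n| + 1) * w4 u v h g y
    + Real.sqrt ε * w4 u1 v1 h1 g1 y + q y)
  be' : ∀ y, 0 < y → y * e y ≤ K * Real.sqrt ε * ((Real.sqrt ε * |n| + 1) * w4 u v h g y
    + Real.sqrt ε * w4 u1 v1 h1 g1 y + q y)
  e1 : ∀ y, 0 < y → Complex.I * (n:ℂ) * ((cu y:ℂ) * u y - (G y:ℂ) * h y) + E1 y
    + Complex.I * (n:ℂ) * p y - ((μ * ε : ℝ):ℂ) * (u2 y - (n:ℂ)^2 * u y) = R1 y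
  e2 : ∀ y, 0 < y → Complex.I * (n:ℂ) * ((cu y:ℂ) * v y - (G y:ℂ) * g y) + E2 y + p1 y
      - ((μ * ε : ℝ):ℂ) * (v2 y - (n:ℂ)^2 * v y) = R2 y
  e3 : ∀ y, 0 < y → -(Complex.I * (n:ℂ)) * u y + E3 y
      - ((κ * ε : ℝ):ℂ) * (h2 y - (n:ℂ)^2 * h y) = R3 y
  e4 : ∀ y, 0 < y → -(Complex.I * (n:ℂ)) * v y + E4 y
      - ((κ * ε : ℝ):ℂ) * (g2 y - (n:ℂ)^2 * g y) = R4 y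
  d : ∀ y, 0 < y → Complex.I * (n:ℂ) * u y + v1 y = 0
  u0 : u 0 = 0
  v0 : v 0 = 0
  h10 : h1 0 = 0
  g0 : g 0 = 0
  lW : Tendsto (fun y => ‖u y‖ + ‖v y‖ + ‖h y‖ + ‖g y‖) atTop (nhds 0)
  lW1 : Tendsto (fun y => ‖u1 y‖ + ‖v1 y‖ + ‖h1 y‖ + ‖g1 y‖) atTop (nhds 0)
  lp : Tendsto (fun y => ‖p y‖ * (‖u y‖ + ‖v y‖ + ‖h y‖ + ‖g y‖)) atTop (nhds 0)
  mW : MemLp (w4 u v h g) 2 (volume.restrict (Ioi 0))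
  mW1 : MemLp (w4 u1 v1 h1 g1) 2 (volume.restrict (Ioi 0))
  mR : MemLp (w4 R1 R2 R3 R4) 2 (volume.restrict (Ioi 0))
  mq : MemLp q 2 (volume.restrict (Ioi 0))
  q0 : ∀ y, 0 ≤ q y
  qle : ∫ y in Ioi (0:ℝ), q y ^ 2 ≤ 4 * ∫ y in Ioi (0:ℝ), w4 u v h g y ^ 2

section
variable {μ κ γ₀ K ε n : ℝ} {cu G G1 e q : ℝ → ℝ}
    {u v h g u1 v1 h1 g1 u2 v2 h2 g2 p p1 E1 E2 E3 E4 R1 R2 R3 R4 : ℝ → ℂ}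

set_option maxHeartbeats 2000000 in
/-- energy inequality with a general weight -/
lemma Core.energy (c : Core μ κ γ₀ K ε n cu G G1 e q
      u v h g u1 v1 h1 g1 u2 v2 h2 g2 p p1 E1 E2 E3 E4 R1 R2 R3 R4)
    {ζ ζ1 ζ2 B : ℝ → ℝ} (L : ℝ) (dζ : ∀ y, HasDerivAt ζ (ζ1 y) y)
    (dζ1 : ∀ y, HasDerivAt ζ1 (ζ2 y) y) (ζ0 : ∀ y, 0 ≤ y → 0 ≤ ζ y ∧ ζ y ≤ L)
    (ζ1b : ∀ y, 0 ≤ y → |ζ1 y| ≤ L) (hB : IntegrableOn B (Ioi 0))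
    (hle : ∀ y, 0 < y → 
      (|ζ1 y| * ((3 * μ + 2 * κ * K) * ε) * (w4 u1 v1 h1 g1 y * w4 u v h g y)
        + 2 * κ * ε * (ζ y * |G1 y|) * (w4 u1 v1 h1 g1 y * w4 u v h g y)
        + (2 + 2 * K) * (ζ y * (e y * w4 u v h g y))
        + (2 + 2 * K) * (ζ y * (w4 R1 R2 R3 R4 y * w4 u v h g y))
        + |ζ1 y| * (|n|⁻¹ * ((w4 R1 R2 R3 R4 y + e y + μ * ε * n ^ 2 * w4 u v h g y) * ‖v y‖))
        + |ζ1 y| * (2 * K * (w4 u v h g y * ‖v y‖))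
        + μ * ε * (|n|⁻¹ * (|ζ2 y| * (w4 u1 v1 h1 g1 y * ‖v y‖)))) ≤ B y) :
    min μ (κ * γ₀) * ε * ((∫ y in Ioi (0:ℝ), ζ y * w4 u1 v1 h1 g1 y ^ 2)
        + n ^ 2 * ∫ y in Ioi (0:ℝ), ζ y * w4 u v h g y ^ 2) ≤ ∫ y in Ioi (0:ℝ), B y := by
  have hpos : ∀ᵐ y ∂(volume.restrict (Ioi (0:ℝ))), 0 < y := ae_restrict_mem measurableSet_Ioi
  have ζc : Continuous ζ := continuous_iff_continuousAt.2 fun y => (dζ y).continuousAt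
  have intζ : ∀ f : ℝ → ℝ, MemLp f 2 (volume.restrict (Ioi 0)) →
      IntegrableOn (fun y => ζ y * f y ^ 2) (Ioi 0) := by
    intro f hf
    refine Integrable.bdd_mul (c := L) hf.integrable_sq ζc.aestronglyMeasurable ?_
    filter_upwards [hpos] with y hy
    rw [Real.norm_of_nonneg (ζ0 y hy.le).1]; exact (ζ0 y hy.le).2
  have i1 := intζ _ c.mW1
  have i2 := intζ _ c.mW
  have hrw : min μ (κ * γ₀) * ε * ((∫ y in Ioi (0:ℝ), ζ y * w4 u1 v1 h1 g1 y ^ 2)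
        + n ^ 2 * ∫ y in Ioi (0:ℝ), ζ y * w4 u v h g y ^ 2) =
      ∫ y in Ioi (0:ℝ), min μ (κ * γ₀) * ε * (ζ y * w4 u1 v1 h1 g1 y ^ 2
        + n ^ 2 * (ζ y * w4 u v h g y ^ 2)) := by
    rw [integral_const_mul, integral_add i1 (i2.const_mul _), integral_const_mul]
  rw [hrw]
  set k : ℝ := n⁻¹ with hkdef
  have hkn : k * n = 1 := inv_mul_cancel₀ c.hn
  have hk : |k| = |n|⁻¹ := abs_inv n
  let Φ : ℝ → ℝ := fun y => μ * ε * (ζ y * (ip (u1 y) (u y) + ip (v1 y) (v y)))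
    + κ * ε * (ζ y * G y * (ip (h1 y) (h y) + ip (g1 y) (g y))) - ζ y * ip (p y) (v y)
    + μ * ε * k * (ζ1 y * ip (-Complex.I * u1 y) (v y))
  let Φ' : ℝ → ℝ := fun y =>
    μ * ε * (ζ1 y * (ip (u1 y) (u y) + ip (v1 y) (v y))
      + ζ y * (ip (u2 y) (u y) + ip (u1 y) (u1 y) + (ip (v2 y) (v y) + ip (v1 y) (v1 y))))
    + κ * ε * ((ζ1 y * G y + ζ y * G1 y) * (ip (h1 y) (h y) + ip (g1 y) (g y))
        + ζ y * G y * (ip (h2 y) (h y) + ip (h1 y) (h1 y) + (ip (g2 y) (g y) + ip (g1 y) (g1 y))))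
      - (ζ1 y * ip (p y) (v y) + ζ y * (ip (p1 y) (v y) + ip (p y) (v1 y)))
      + μ * ε * k * (ζ2 y * ip (-Complex.I * u1 y) (v y)
        + ζ1 y * (ip (-Complex.I * u2 y) (v y) + ip (-Complex.I * u1 y) (v1 y)))
  have hd : ∀ y, HasDerivAt Φ (Φ' y) y := by
    intro y
    have a1 := ((dζ y).mul ((hasDerivAt_ip (c.du1 y) (c.du y)).add
      (hasDerivAt_ip (c.dv1 y) (c.dv y)))).const_mul (μ * ε)
    have a2 := (((dζ y).mul (c.dG y)).mul ((hasDerivAt_ip (c.dh1 y) (c.dh y)).add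
      (hasDerivAt_ip (c.dg1 y) (c.dg y)))).const_mul (κ * ε)
    have a3 := (dζ y).mul (hasDerivAt_ip (c.dp y) (c.dv y))
    have a4 := ((dζ1 y).mul (hasDerivAt_ip ((c.du1 y).const_mul (-Complex.I)) (c.dv y))).const_mul
      (μ * ε * k)
    exact ((a1.add a2).sub a3).add a4
  have hW0 : ∀ y, 0 ≤ w4 u v h g y := w4_nonneg _ _ _ _
  refine flux_le (Φ := Φ) (Φ' := Φ')
    (continuous_iff_continuousAt.2 fun y => (hd y).continuousAt).continuousOn
    (fun y _ => hd y) ?_ ?_ ((i1.add (i2.const_mul _)).const_mul _) hB ?_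
  · simp [Φ, ip, c.u0, c.v0, c.h10, c.g0]
  · -- decay
    have hL : 0 ≤ L := (ζ0 0 le_rfl).1.trans (ζ0 0 le_rfl).2
    have hK := c.hK
    have hε := c.hε
    have hμ := c.hμ
    have hκ := c.hκ
    have hlim : Tendsto (fun y => (μ * ε * (L * 2) + κ * ε * (L * K * 2)
        + μ * ε * |n|⁻¹ * L) * ((‖u1 y‖ + ‖v1 y‖ + ‖h1 y‖ + ‖g1 y‖)
          * (‖u y‖ + ‖v y‖ + ‖h y‖ + ‖g y‖))
        + L * (‖p y‖ * (‖u y‖ + ‖v y‖ + ‖h y‖ + ‖g y‖))) atTop (nhds 0) := by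
      have := ((c.lW1.mul c.lW).const_mul (μ * ε * (L * 2) + κ * ε * (L * K * 2)
        + μ * ε * |n|⁻¹ * L)).add (c.lp.const_mul L)
      simpa using this
    refine squeeze_zero_norm' ?_ hlim
    filter_upwards [eventually_ge_atTop 0] with y hy
    have z0 := ζ0 y hy
    have z1 := ζ1b y hy
    have gb := c.bG y hy
    have g0 : 0 ≤ G y := c.hγ₀.le.trans gb.1
    set X := (‖u1 y‖ + ‖v1 y‖ + ‖h1 y‖ + ‖g1 y‖) with hX
    set V := (‖u y‖ + ‖v y‖ + ‖h y‖ + ‖g y‖) with hV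
    have nu := norm_nonneg (u y)
    have nv := norm_nonneg (v y)
    have nh := norm_nonneg (h y)
    have ng := norm_nonneg (g y)
    have nu1 := norm_nonneg (u1 y)
    have nv1 := norm_nonneg (v1 y)
    have nh1 := norm_nonneg (h1 y)
    have ng1 := norm_nonneg (g1 y)
    have X0 : 0 ≤ X := by positivity
    have V0 : 0 ≤ V := by positivity
    have b1 := ip_le' (show ‖u1 y‖ ≤ X by linarith) (show ‖u y‖ ≤ V by linarith)
    have b2 := ip_le' (show ‖v1 y‖ ≤ X by linarith) (show ‖v y‖ ≤ V by linarith)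
    have b3 := ip_le' (show ‖h1 y‖ ≤ X by linarith) (show ‖h y‖ ≤ V by linarith)
    have b4 := ip_le' (show ‖g1 y‖ ≤ X by linarith) (show ‖g y‖ ≤ V by linarith)
    have b5 := ip_le' (le_refl ‖p y‖) (show ‖v y‖ ≤ V by linarith)
    have b6 := ip_le' (show ‖-Complex.I * u1 y‖ ≤ X by
      rw [norm_mul, norm_neg, Complex.norm_I, one_mul]; linarith) (show ‖v y‖ ≤ V by linarith)
    have q1 : |μ * ε * (ζ y * (ip (u1 y) (u y) + ip (v1 y) (v y)))| ≤
        μ * ε * (L * (2 * (X * V))) := by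
      rw [abs_mul, abs_mul (ζ y), abs_of_pos (mul_pos hμ hε), abs_of_nonneg z0.1]
      gcongr
      · exact z0.2
      · refine (abs_add_le _ _).trans ?_; linarith
    have q2 : |κ * ε * (ζ y * G y * (ip (h1 y) (h y) + ip (g1 y) (g y)))| ≤
        κ * ε * (L * K * (2 * (X * V))) := by
      rw [abs_mul, abs_mul (ζ y * G y), abs_mul (ζ y), abs_of_pos (mul_pos hκ hε), abs_of_nonneg z0.1,
        abs_of_nonneg g0]
      gcongr
      · exact z0.2
      · exact gb.2
      · refine (abs_add_le _ _).trans ?_; linarith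
    have q3 : |ζ y * ip (p y) (v y)| ≤ L * (‖p y‖ * V) := by
      rw [abs_mul, abs_of_nonneg z0.1]
      gcongr
      exact z0.2
    have q4 : |μ * ε * k * (ζ1 y * ip (-Complex.I * u1 y) (v y))| ≤
        μ * ε * |n|⁻¹ * (L * (X * V)) := by
      rw [abs_mul, abs_mul, abs_mul (ζ1 y), hk, abs_of_pos (mul_pos hμ hε)]
      gcongr
    rw [Real.norm_eq_abs]
    refine (abs_add_le _ _).trans ?_
    refine (add_le_add ((abs_sub _ _).trans (add_le_add (abs_add_le _ _) le_rfl)) le_rfl).trans ?_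
    refine (add_le_add (add_le_add (add_le_add q1 q2) q3) q4).trans (le_of_eq ?_)
    ring
  · intro y hy
    have lw := le_w4 u v h g y
    have lw1 := le_w4 u1 v1 h1 g1 y
    have lr := le_w4 R1 R2 R3 R4 y
    have bE := c.bE y hy
    have := pt_lower μ κ γ₀ K ε n k (G y) (G1 y) (cu y) (ζ y) (ζ1 y) (ζ2 y) (w4 u v h g y)
      (w4 u1 v1 h1 g1 y) (w4 R1 R2 R3 R4 y) (e y) c.hμ c.hκ c.hγ₀ c.hε hk c.hn (ζ0 y hy.le).1
      (c.bG y hy.le).1 (c.bG y hy.le).2 (c.bcu y hy) (u y) (v y) (h y) (g y) (u1 y) (v1 y) (h1 y)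
      (g1 y) (E1 y) (E2 y) (E3 y) (E4 y) (R1 y) (R2 y) (R3 y) (R4 y)
      lw.1 lw.2.1 lw.2.2.1 lw.2.2.2 lw1.1 lw1.2.1 lw1.2.2.1 lw1.2.2.2
      bE.1 bE.2.1 bE.2.2.1 bE.2.2.2 lr.1 lr.2.1 lr.2.2.1 lr.2.2.2
      (w4_sq _ _ _ _ _) (w4_sq _ _ _ _ _)
    rw [← pt_identity n k (μ * ε) (κ * ε) (G y) (G1 y) (cu y) (ζ y) (ζ1 y) (ζ2 y) hkn (u y) (v y)
      (h y) (g y) (u1 y) (v1 y) (h1 y) (g1 y) (u2 y) (v2 y) (h2 y) (g2 y) (p y) (p1 y)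
      (E1 y) (E2 y) (E3 y) (E4 y) (R1 y) (R2 y) (R3 y) (R4 y)
      (c.e1 y hy) (c.e2 y hy) (c.e3 y hy) (c.e4 y hy) (c.d y hy)] at this
    refine le_trans ?_ this
    have h2 := hle y hy
    have h3 : min μ (κ * γ₀) * ε * (ζ y * w4 u1 v1 h1 g1 y ^ 2
        + n ^ 2 * (ζ y * w4 u v h g y ^ 2)) =
        ζ y * (min μ (κ * γ₀) * ε * (w4 u1 v1 h1 g1 y ^ 2 + n ^ 2 * w4 u v h g y ^ 2)) := by ring
    exact sub_le_sub h3.le h2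

end

lemma int3 {ν : Measure ℝ} {f1 f2 f3 : ℝ → ℝ} {a b c : ℝ} (h1 : Integrable f1 ν)
    (h2 : Integrable f2 ν) (h3 : Integrable f3 ν) :
    ∫ y, (a * f1 y + b * f2 y + c * f3 y) ∂ν =
      a * (∫ y, f1 y ∂ν) + b * (∫ y, f2 y ∂ν) + c * ∫ y, f3 y ∂ν := by
  have h12 : Integrable (fun y => a * f1 y + b * f2 y) ν := (h1.const_mul a).add (h2.const_mul b)
  rw [integral_add h12 (h3.const_mul c), integral_add (h1.const_mul a) (h2.const_mul b),
    integral_const_mul, integral_const_mul, integral_const_mul]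

/-- the constant of the unweighted estimate -/
def CJ (μ κ γ₀ K : ℝ) : ℝ :=
  20 + 4 * (2 / min μ (κ * γ₀)) * ((2 * κ * K + (2 + 2 * K) * K) + (5 / 2 * min μ (κ * γ₀)
    + 2 * (2 * κ * K + (2 + 2 * K) * K) ^ 2 / min μ (κ * γ₀)))

lemma CJ_num {c C X M2 M W R : ℝ} (hc : 0 < c) (hC : 0 < C) (hW : 0 ≤ W) (hR : 0 ≤ R)
    (hM : M ^ 2 = M2) (h1 : c * X ≤ C * (R * W + M * W)) (h2 : M2 ≤ 4 * X + 20 * W ^ 2) :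
    M2 ≤ (20 + 4 * (2 / c) * (C + (5 / 2 * c + 2 * C ^ 2 / c))) * (R * W + W ^ 2) := by
  have h3 : C * (M * W) ≤ c / 8 * M ^ 2 + 2 * C ^ 2 / c * W ^ 2 := by
    have : c / 8 * M ^ 2 + 2 * C ^ 2 / c * W ^ 2 - C * (M * W) =
        c / 8 * (M - 4 * C * W / c) ^ 2 := by
      field_simp; ring
    have h0 : 0 ≤ c / 8 * (M - 4 * C * W / c) ^ 2 := by positivity
    linarith
  have h4 : c / 2 * X ≤ C * (R * W) + (5 / 2 * c + 2 * C ^ 2 / c) * W ^ 2 := by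
    rw [hM] at h3
    nlinarith
  have h5 : X ≤ 2 / c * (C * (R * W) + (5 / 2 * c + 2 * C ^ 2 / c) * W ^ 2) := by
    have := mul_le_mul_of_nonneg_left h4 (show 0 ≤ 2 / c by positivity)
    have e : 2 / c * (c / 2 * X) = X := by field_simp
    rwa [e] at this
  have hRW : 0 ≤ R * W := mul_nonneg hR hW
  set b := 5 / 2 * c + 2 * C ^ 2 / c with hb
  have hb0 : 0 < b := by positivity
  have h6 : C * (R * W) + b * W ^ 2 ≤ (C + b) * (R * W + W ^ 2) := by
    nlinarith [mul_nonneg hC.le (sq_nonneg W), mul_nonneg hb0.le hRW]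
  have h7 : 2 / c * (C * (R * W) + b * W ^ 2) ≤ 2 / c * ((C + b) * (R * W + W ^ 2)) := by
    gcongr
  nlinarith

section
variable {μ κ γ₀ K ε n : ℝ} {cu G G1 e q : ℝ → ℝ}
    {u v h g u1 v1 h1 g1 u2 v2 h2 g2 p p1 E1 E2 E3 E4 R1 R2 R3 R4 : ℝ → ℂ}

/-- the majorant of the lower order terms -/
def mfun (ε n : ℝ) (u v h g u1 v1 h1 g1 : ℝ → ℂ) (q : ℝ → ℝ) : ℝ → ℝ := fun y =>
  (Real.sqrt ε * |n| + 1) * w4 u v h g y + Real.sqrt ε * w4 u1 v1 h1 g1 y + q y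

lemma Core.mm (c : Core μ κ γ₀ K ε n cu G G1 e q
      u v h g u1 v1 h1 g1 u2 v2 h2 g2 p p1 E1 E2 E3 E4 R1 R2 R3 R4) :
    MemLp (mfun ε n u v h g u1 v1 h1 g1 q) 2 (volume.restrict (Ioi 0)) :=
  ((c.mW.const_mul _).add (c.mW1.const_mul _)).add c.mq

lemma Core.m0 (c : Core μ κ γ₀ K ε n cu G G1 e q
      u v h g u1 v1 h1 g1 u2 v2 h2 g2 p p1 E1 E2 E3 E4 R1 R2 R3 R4) (y : ℝ) :
    Real.sqrt ε * |n| * w4 u v h g y ≤ mfun ε n u v h g u1 v1 h1 g1 q y ∧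
    Real.sqrt ε * w4 u1 v1 h1 g1 y ≤ mfun ε n u v h g u1 v1 h1 g1 q y ∧
    0 ≤ mfun ε n u v h g u1 v1 h1 g1 q y := by
  have a := w4_nonneg u v h g y
  have b := w4_nonneg u1 v1 h1 g1 y
  have d := c.q0 y
  have s := Real.sqrt_nonneg ε
  have t := mul_nonneg (mul_nonneg s (abs_nonneg n)) a
  have t2 := mul_nonneg s b
  refine ⟨?_, ?_, ?_⟩ <;> simp only [mfun] <;> linarith

lemma Core.unweighted (c : Core μ κ γ₀ K ε n cu G G1 e q
      u v h g u1 v1 h1 g1 u2 v2 h2 g2 p p1 E1 E2 E3 E4 R1 R2 R3 R4) :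
    ∫ y in Ioi (0:ℝ), mfun ε n u v h g u1 v1 h1 g1 q y ^ 2 ≤
      CJ μ κ γ₀ K * (Real.sqrt (∫ y in Ioi (0:ℝ), w4 R1 R2 R3 R4 y ^ 2) *
        Real.sqrt (∫ y in Ioi (0:ℝ), w4 u v h g y ^ 2)
        + Real.sqrt (∫ y in Ioi (0:ℝ), w4 u v h g y ^ 2) ^ 2) := by
  have hμ := c.hμ
  have hκ := c.hκ
  have hγ := c.hγ₀
  have hK := c.hK
  have hε := c.hε
  have mm := c.mm
  have hs : Real.sqrt ε ^ 2 = ε := Real.sq_sqrt hε.le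
  have hs0 : 0 < Real.sqrt ε := Real.sqrt_pos.2 hε
  set C : ℝ := 2 * κ * K + (2 + 2 * K) * K with hC
  have irw : IntegrableOn (fun y => w4 R1 R2 R3 R4 y * w4 u v h g y) (Ioi 0) :=
    c.mR.integrable_mul c.mW
  have imw : IntegrableOn (fun y => mfun ε n u v h g u1 v1 h1 g1 q y * w4 u v h g y) (Ioi 0) :=
    mm.integrable_mul c.mW
  have hB : IntegrableOn (fun y => C * (w4 R1 R2 R3 R4 y * w4 u v h g y
      + mfun ε n u v h g u1 v1 h1 g1 q y * w4 u v h g y)) (Ioi 0) :=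
    (irw.add imw).const_mul C
  have en := c.energy (ζ := fun _ => 1) (ζ1 := fun _ => 0) (ζ2 := fun _ => 0) (L := 1)
    (fun y => hasDerivAt_const _ _) (fun y => hasDerivAt_const _ _) (fun y _ => by norm_num)
    (fun y _ => by norm_num) hB (fun y hy => by
      have a := w4_nonneg u v h g y
      have b := w4_nonneg u1 v1 h1 g1 y
      have r0 := w4_nonneg R1 R2 R3 R4 y
      obtain ⟨_, m1, m0⟩ := c.m0 y
      have g1b := (c.bG1 y hy).1
      have eb : e y ≤ K * mfun ε n u v h g u1 v1 h1 g1 q y := c.be y hy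
      set m := mfun ε n u v h g u1 v1 h1 g1 q y
      set W := w4 u v h g y
      set W1 := w4 u1 v1 h1 g1 y
      set r := w4 R1 R2 R3 R4 y
      have x1 : 2 * κ * ε * (1 * |G1 y|) * (W1 * W) ≤ 2 * κ * K * (m * W) := by
        calc 2 * κ * ε * (1 * |G1 y|) * (W1 * W)
            = 2 * κ * (|G1 y| * Real.sqrt ε) * ((Real.sqrt ε * W1) * W) := by
              linear_combination (-2 * κ * |G1 y| * W1 * W) * hs
          _ ≤ 2 * κ * K * (m * W) := by gcongr
      have x2 : (2 + 2 * K) * (1 * (e y * W)) ≤ (2 + 2 * K) * K * (m * W) := by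
        calc (2 + 2 * K) * (1 * (e y * W)) ≤ (2 + 2 * K) * (1 * ((K * m) * W)) := by gcongr
          _ = _ := by ring
      have x3 : (2 + 2 * K) * (1 * (r * W)) ≤ C * (r * W) := by
        rw [one_mul]
        refine mul_le_mul_of_nonneg_right ?_ (by positivity)
        nlinarith [mul_nonneg hκ.le (by linarith : (0:ℝ) ≤ K)]
      simp only [abs_zero, zero_mul, mul_zero, add_zero, zero_add]
      have : C * (m * W) = 2 * κ * K * (m * W) + (2 + 2 * K) * K * (m * W) := by rw [hC]; ring
      linarith)
  simp only [one_mul] at en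
  rw [integral_const_mul, integral_add irw imw] at en
  have cs1 := cs_int (Eventually.of_forall (w4_nonneg R1 R2 R3 R4))
    (Eventually.of_forall (w4_nonneg u v h g)) c.mR c.mW
  have cs2 := cs_int (Eventually.of_forall (fun y => (c.m0 y).2.2))
    (Eventually.of_forall (w4_nonneg u v h g)) mm c.mW
  set W2 := ∫ y in Ioi (0:ℝ), w4 u v h g y ^ 2
  set M2 := ∫ y in Ioi (0:ℝ), mfun ε n u v h g u1 v1 h1 g1 q y ^ 2
  set R2' := ∫ y in Ioi (0:ℝ), w4 R1 R2 R3 R4 y ^ 2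
  set X2 := ∫ y in Ioi (0:ℝ), w4 u1 v1 h1 g1 y ^ 2
  have hC0 : 0 < C := by positivity
  have M20 : 0 ≤ M2 := integral_nonneg fun y => by positivity
  have W20 : 0 ≤ W2 := integral_nonneg fun y => by positivity
  have hmle : M2 ≤ 4 * (ε * (X2 + n ^ 2 * W2)) + 20 * Real.sqrt W2 ^ 2 := by
    have i1 := c.mW.integrable_sq
    have i2 := c.mW1.integrable_sq
    have i3 := c.mq.integrable_sq
    have : M2 ≤ ∫ y in Ioi (0:ℝ), ((4 * (ε * n ^ 2) + 4) * w4 u v h g y ^ 2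
        + (4 * ε) * w4 u1 v1 h1 g1 y ^ 2 + 4 * q y ^ 2) := by
      refine integral_mono mm.integrable_sq
        (((i1.const_mul _).add (i2.const_mul _)).add (i3.const_mul _)) (fun y => ?_)
      have key : ∀ a b c d : ℝ, (a + b + c + d) ^ 2 ≤ 4 * (a ^ 2 + b ^ 2 + c ^ 2 + d ^ 2) := by
        intro a b c d
        nlinarith [sq_nonneg (a - b), sq_nonneg (a - c), sq_nonneg (a - d), sq_nonneg (b - c),
          sq_nonneg (b - d), sq_nonneg (c - d)]
      have k1 := key (Real.sqrt ε * |n| * w4 u v h g y) (w4 u v h g y)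
        (Real.sqrt ε * w4 u1 v1 h1 g1 y) (q y)
      simp only [mul_pow, hs, sq_abs] at k1
      simp only [mfun]
      calc _ = (Real.sqrt ε * |n| * w4 u v h g y + w4 u v h g y
            + Real.sqrt ε * w4 u1 v1 h1 g1 y + q y) ^ 2 := by ring
        _ ≤ _ := k1
        _ = _ := by ring
    rw [int3 i1 i2 i3] at this
    rw [Real.sq_sqrt W20]
    have hq := c.qle
    linarith
  refine CJ_num (c := min μ (κ * γ₀)) (C := C) (X := ε * (X2 + n ^ 2 * W2)) (M := Real.sqrt M2)
    (lt_min hμ (by positivity)) hC0 (Real.sqrt_nonneg _) (Real.sqrt_nonneg _) (Real.sq_sqrt M20)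
    ?_ hmle
  rw [← mul_assoc]
  refine en.trans ?_
  gcongr
end

lemma memLp_loc {f : ℝ → ℝ} (hf : MemLp f 2 (volume.restrict (Ioi 0))) :
    IntegrableOn f (Ioc 0 2) := by
  have hf2 : MemLp f 2 (volume.restrict (Ioc 0 2)) :=
    hf.mono_measure (Measure.restrict_mono Ioc_subset_Ioi_self le_rfl)
  exact hf2.integrable one_le_two

section
variable {μ κ γ₀ K ε n : ℝ} {cu G G1 e q : ℝ → ℝ}
    {u v h g u1 v1 h1 g1 u2 v2 h2 g2 p p1 E1 E2 E3 E4 R1 R2 R3 R4 : ℝ → ℂ}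

lemma Core.v1_norm (c : Core μ κ γ₀ K ε n cu G G1 e q
      u v h g u1 v1 h1 g1 u2 v2 h2 g2 p p1 E1 E2 E3 E4 R1 R2 R3 R4) {y : ℝ} (hy : 0 < y) :
    ‖v1 y‖ ≤ |n| * w4 u v h g y := by
  have hd0 := c.d y hy
  have e : v1 y = -(Complex.I * (n:ℂ) * u y) := by linear_combination hd0
  rw [e, norm_neg, norm_mul, norm_mul, Complex.norm_I, one_mul, Complex.norm_real,
    Real.norm_eq_abs]
  gcongr
  exact (le_w4 u v h g y).1

lemma Core.v_sup (c : Core μ κ γ₀ K ε n cu G G1 e q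
      u v h g u1 v1 h1 g1 u2 v2 h2 g2 p p1 E1 E2 E3 E4 R1 R2 R3 R4) {y : ℝ} (hy : 0 < y)
      (hy2 : y ≤ 2) : ‖v y‖ ≤ |n| * ∫ t in Ioc (0:ℝ) 2, w4 u v h g t := by
  have cv1 : Continuous v1 := continuous_iff_continuousAt.2 fun y => (c.dv1 y).continuousAt
  have e : ∫ t in (0:ℝ)..y, v1 t = v y - v 0 :=
    intervalIntegral.integral_eq_sub_of_hasDerivAt (fun t _ => c.dv t)
      (cv1.intervalIntegrable _ _)
  rw [c.v0, sub_zero] at e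
  rw [← e]
  have hi := memLp_loc c.mW
  have hi2 : IntegrableOn (fun t => |n| * w4 u v h g t) (Ioc 0 2) := hi.const_mul _
  have h1 := intervalIntegral.norm_integral_le_of_norm_le (μ := volume) (f := v1)
    (g := fun t => |n| * w4 u v h g t) hy.le
    (Eventually.of_forall fun t ht => c.v1_norm ht.1)
    (by
      rw [intervalIntegrable_iff_integrableOn_Ioc_of_le hy.le]
      exact hi2.mono_set (Ioc_subset_Ioc_right hy2))
  refine h1.trans ?_
  rw [intervalIntegral.integral_of_le hy.le, ← integral_const_mul]
  refine setIntegral_mono_set hi2 (Eventually.of_forall fun t => ?_)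
    (Ioc_subset_Ioc_right hy2).eventuallyLE
  exact mul_nonneg (abs_nonneg _) (w4_nonneg _ _ _ _ _)

lemma Core.v_hardy (c : Core μ κ γ₀ K ε n cu G G1 e q
      u v h g u1 v1 h1 g1 u2 v2 h2 g2 p p1 E1 E2 E3 E4 R1 R2 R3 R4) :
    MemLp (fun y => ‖dslope v 0 y‖ * |n|⁻¹) 2 (volume.restrict (Ioi 0)) ∧
    ∫ y in Ioi (0:ℝ), (‖dslope v 0 y‖ * |n|⁻¹) ^ 2 ≤ 4 * ∫ y in Ioi (0:ℝ), w4 u v h g y ^ 2 := by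
  have cv1 : Continuous v1 := continuous_iff_continuousAt.2 fun y => (c.dv1 y).continuousAt
  have cs := dslope_cont c.dv
  have hn : 0 < |n| := abs_pos.2 c.hn
  have hL : ML2 v1 := by
    refine Integrable.mono' c.mW1.integrable_sq (by fun_prop) (Eventually.of_forall fun y => ?_)
    rw [Real.norm_of_nonneg (by positivity)]
    have := (le_w4 u1 v1 h1 g1 y).2.1
    gcongr
  obtain ⟨a, b⟩ := hardy c.dv cv1 c.v0 hL
  have hv : nsq v1 ≤ |n| ^ 2 * ∫ y in Ioi (0:ℝ), w4 u v h g y ^ 2 := by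
    rw [nsq, ← integral_const_mul]
    refine setIntegral_mono_on hL (c.mW.integrable_sq.const_mul _) measurableSet_Ioi ?_
    intro y hy
    rw [← mul_pow]
    exact pow_le_pow_left₀ (norm_nonneg _) (c.v1_norm hy) 2
  refine ⟨?_, ?_⟩
  · rw [memLp_two_iff_integrable_sq (by fun_prop)]
    simp only [mul_pow]
    exact a.mul_const _
  · simp only [mul_pow]
    rw [integral_mul_const]
    calc _ ≤ 4 * (|n| ^ 2 * ∫ y in Ioi (0:ℝ), w4 u v h g y ^ 2) * |n|⁻¹ ^ 2 := by
          gcongr; linarith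
      _ = _ := by field_simp

set_option maxHeartbeats 2000000 in
lemma Core.weighted (c : Core μ κ γ₀ K ε n cu G G1 e q
      u v h g u1 v1 h1 g1 u2 v2 h2 g2 p p1 E1 E2 E3 E4 R1 R2 R3 R4)
    {Z Z1 Z2 : ℝ → ℝ} (dZ : ∀ y, HasDerivAt Z (Z1 y) y) (dZ1 : ∀ y, HasDerivAt Z1 (Z2 y) y)
    (Z0 : ∀ y, 0 ≤ y → 0 ≤ Z y ∧ Z y ≤ K) (Zy : ∀ y, 0 ≤ y → Z y ≤ K * y)
    (Z1b : ∀ y, 0 ≤ y → |Z1 y| ≤ K) (Z1z : ∀ y, 2 < y → Z1 y = 0)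
    (Z2b : ∀ y, 0 ≤ y → y * |Z2 y| ≤ K) :
    min μ (κ * γ₀) * ε * ((∫ y in Ioi (0:ℝ), Z y * w4 u1 v1 h1 g1 y ^ 2)
        + n ^ 2 * ∫ y in Ioi (0:ℝ), Z y * w4 u v h g y ^ 2) ≤
    (4 * μ * K + 4 * κ * K ^ 2 + (3 + 2 * K) * K ^ 2) * Real.sqrt ε *
        (Real.sqrt (∫ y in Ioi (0:ℝ), mfun ε n u v h g u1 v1 h1 g1 q y ^ 2) *
          (3 * Real.sqrt (∫ y in Ioi (0:ℝ), w4 u v h g y ^ 2)))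
      + (2 + 2 * K) * (Real.sqrt (∫ y in Ioi (0:ℝ), Z y * w4 R1 R2 R3 R4 y ^ 2) *
          Real.sqrt (∫ y in Ioi (0:ℝ), Z y * w4 u v h g y ^ 2))
      + (K * ((∫ y in Ioc (0:ℝ) 2, w4 R1 R2 R3 R4 y) * (∫ y in Ioc (0:ℝ) 2, w4 u v h g y))
        + 2 * K ^ 2 * (|n| * (∫ y in Ioc (0:ℝ) 2, w4 u v h g y) ^ 2)) := by
  have hμ := c.hμ
  have hκ := c.hκ
  have hγ := c.hγ₀
  have hK := c.hK
  have hK0 : 0 < K := by linarith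
  have hε := c.hε
  have hn : 0 < |n| := abs_pos.2 c.hn
  have mm := c.mm
  have hs : Real.sqrt ε ^ 2 = ε := Real.sq_sqrt hε.le
  have hs0 : 0 < Real.sqrt ε := Real.sqrt_pos.2 hε
  obtain ⟨mqv, iqv⟩ := c.v_hardy
  set qv : ℝ → ℝ := fun y => ‖dslope v 0 y‖ * |n|⁻¹ with hqv
  have qv0 : ∀ y, 0 ≤ qv y := fun y => by rw [hqv]; positivity
  set I := ∫ y in Ioc (0:ℝ) 2, w4 u v h g y with hI
  have I0 : 0 ≤ I := integral_nonneg fun y => w4_nonneg _ _ _ _ _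
  set Cb : ℝ := 4 * μ * K + 4 * κ * K ^ 2 + (3 + 2 * K) * K ^ 2 with hCb
  have hCb0 : 0 < Cb := by positivity
  have hpos : ∀ᵐ y ∂(volume.restrict (Ioi (0:ℝ))), 0 < y := ae_restrict_mem measurableSet_Ioi
  have Zc : Continuous Z := continuous_iff_continuousAt.2 fun y => (dZ y).continuousAt
  have mZ : ∀ f : ℝ → ℝ, MemLp f 2 (volume.restrict (Ioi 0)) →
      MemLp (fun y => Real.sqrt (Z y) * f y) 2 (volume.restrict (Ioi 0)) := by
    intro f hf
    refine MemLp.of_le_mul (c := Real.sqrt K) hf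
      ((by fun_prop : AEStronglyMeasurable (fun y : ℝ => Real.sqrt (Z y)) _).mul hf.1) ?_
    filter_upwards [hpos] with y hy
    rw [norm_mul, Real.norm_of_nonneg (Real.sqrt_nonneg _)]
    gcongr; exact (Z0 y hy.le).2
  have mZr := mZ _ c.mR
  have mZw := mZ _ c.mW
  have i1 : IntegrableOn (fun y => mfun ε n u v h g u1 v1 h1 g1 q y * (w4 u v h g y + qv y))
      (Ioi 0) := mm.integrable_mul (c.mW.add mqv)
  have i2 : IntegrableOn (fun y => (Real.sqrt (Z y) * w4 R1 R2 R3 R4 y) *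
      (Real.sqrt (Z y) * w4 u v h g y)) (Ioi 0) := mZr.integrable_mul mZw
  have i3' : IntegrableOn (fun y => K * (w4 R1 R2 R3 R4 y + 2 * K * |n| * w4 u v h g y) * I)
      (Ioc 0 2) :=
    (((memLp_loc c.mR).add ((memLp_loc c.mW).const_mul _)).const_mul K).mul_const I
  have i3 : IntegrableOn ((Ioc (0:ℝ) 2).indicator
      (fun y => K * (w4 R1 R2 R3 R4 y + 2 * K * |n| * w4 u v h g y) * I)) (Ioi 0) :=
    (i3'.integrable_indicator measurableSet_Ioc).integrableOn
  have i3e : ∫ y in Ioi (0:ℝ), (Ioc (0:ℝ) 2).indicator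
      (fun y => K * (w4 R1 R2 R3 R4 y + 2 * K * |n| * w4 u v h g y) * I) y =
      K * ((∫ y in Ioc (0:ℝ) 2, w4 R1 R2 R3 R4 y) * I) + 2 * K ^ 2 * (|n| * I ^ 2) := by
    rw [setIntegral_indicator measurableSet_Ioc,
      Set.inter_eq_self_of_subset_right Ioc_subset_Ioi_self, integral_mul_const,
      integral_const_mul, integral_add (memLp_loc c.mR) ((memLp_loc c.mW).const_mul _),
      integral_const_mul]
    ring
  have hB : IntegrableOn (fun y => Cb * Real.sqrt ε *
        (mfun ε n u v h g u1 v1 h1 g1 q y * (w4 u v h g y + qv y))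
      + (2 + 2 * K) * ((Real.sqrt (Z y) * w4 R1 R2 R3 R4 y) * (Real.sqrt (Z y) * w4 u v h g y))
      + 1 * (Ioc (0:ℝ) 2).indicator
        (fun y => K * (w4 R1 R2 R3 R4 y + 2 * K * |n| * w4 u v h g y) * I) y) (Ioi 0) :=
    ((i1.const_mul _).add (i2.const_mul _)).add (i3.const_mul _)
  have en := c.energy (ζ := Z) (ζ1 := Z1) (ζ2 := Z2) (L := K) dZ dZ1 Z0 Z1b hB (fun y hy => by
    have a := w4_nonneg u v h g y
    have b := w4_nonneg u1 v1 h1 g1 y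
    have r0 := w4_nonneg R1 R2 R3 R4 y
    obtain ⟨m2, m1, m0⟩ := c.m0 y
    have g1b := (c.bG1 y hy).2
    have eb : y * e y ≤ K * Real.sqrt ε * mfun ε n u v h g u1 v1 h1 g1 q y := c.be' y hy
    have e0 : 0 ≤ e y := (norm_nonneg _).trans (c.bE y hy).1
    have vy : ‖v y‖ = y * |n| * qv y := by
      rw [hqv]; simp only; rw [dslope_zero_norm c.v0 hy]; field_simp
    have vW : ‖v y‖ ≤ w4 u v h g y := (le_w4 u v h g y).2.1
    have z0 := (Z0 y hy.le).1
    have zy := Zy y hy.le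
    have z1 := Z1b y hy.le
    have z2 := Z2b y hy.le
    have q0 := qv0 y
    have loc : |Z1 y| * (|n|⁻¹ * (w4 R1 R2 R3 R4 y * ‖v y‖))
        + |Z1 y| * (2 * K * (w4 u v h g y * ‖v y‖)) ≤ (Ioc (0:ℝ) 2).indicator
        (fun y => K * (w4 R1 R2 R3 R4 y + 2 * K * |n| * w4 u v h g y) * I) y := by
      by_cases hy2 : y ≤ 2
      · rw [indicator_of_mem (show y ∈ Ioc (0:ℝ) 2 from ⟨hy, hy2⟩)]
        have vs := c.v_sup hy hy2
        rw [← hI] at vs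
        calc _ = |Z1 y| * (|n|⁻¹ * w4 R1 R2 R3 R4 y + 2 * K * w4 u v h g y) * ‖v y‖ := by ring
          _ ≤ K * (|n|⁻¹ * w4 R1 R2 R3 R4 y + 2 * K * w4 u v h g y) * (|n| * I) := by gcongr
          _ = _ := by field_simp
      · rw [indicator_of_notMem (fun h => hy2 h.2), Z1z y (not_le.1 hy2)]
        simp
    have sqz : Real.sqrt (Z y) ^ 2 = Z y := Real.sq_sqrt z0
    set m := mfun ε n u v h g u1 v1 h1 g1 q y
    set W := w4 u v h g y
    set W1 := w4 u1 v1 h1 g1 y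
    set r := w4 R1 R2 R3 R4 y
    set s := Real.sqrt ε
    have x1 : |Z1 y| * ((3 * μ + 2 * κ * K) * ε) * (W1 * W) ≤
        (3 * μ * K + 2 * κ * K ^ 2) * s * (m * W) := by
      calc _ = |Z1 y| * ((3 * μ + 2 * κ * K) * s) * ((s * W1) * W) := by
            rw [← hs]; ring
        _ ≤ K * ((3 * μ + 2 * κ * K) * s) * (m * W) := by gcongr
        _ = _ := by ring
    have x2 : 2 * κ * ε * (Z y * |G1 y|) * (W1 * W) ≤ 2 * κ * K ^ 2 * s * (m * W) := by
      calc _ ≤ 2 * κ * ε * ((K * y) * |G1 y|) * (W1 * W) := by gcongr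
        _ = 2 * κ * s * (K * (y * |G1 y|)) * ((s * W1) * W) := by
            rw [← hs]; ring
        _ ≤ 2 * κ * s * (K * K) * (m * W) := by gcongr
        _ = _ := by ring
    have x3 : (2 + 2 * K) * (Z y * (e y * W)) ≤ (2 + 2 * K) * K ^ 2 * s * (m * W) := by
      calc _ ≤ (2 + 2 * K) * ((K * y) * (e y * W)) := by gcongr
        _ = (2 + 2 * K) * (K * (y * e y) * W) := by ring
        _ ≤ (2 + 2 * K) * (K * (K * s * m) * W) := by gcongr
        _ = _ := by ring
    have x5 : |Z1 y| * (|n|⁻¹ * (e y * ‖v y‖)) ≤ K ^ 2 * s * (m * qv y) := by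
      rw [vy]
      calc _ = |Z1 y| * ((y * e y) * qv y) := by field_simp
        _ ≤ K * ((K * s * m) * qv y) := by gcongr
        _ = _ := by ring
    have x6 : |Z1 y| * (|n|⁻¹ * (μ * ε * n ^ 2 * W * ‖v y‖)) ≤ μ * K * s * (m * W) := by
      calc _ = |Z1 y| * (μ * s * ((s * |n| * W) * ‖v y‖)) := by
            rw [← hs, ← sq_abs n]; field_simp
        _ ≤ K * (μ * s * (m * W)) := by gcongr
        _ = _ := by ring
    have x7 : μ * ε * (|n|⁻¹ * (|Z2 y| * (W1 * ‖v y‖))) ≤ μ * K * s * (m * qv y) := by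
      rw [vy]
      calc _ = μ * s * ((y * |Z2 y|) * ((s * W1) * qv y)) := by
            rw [← hs]; field_simp
        _ ≤ μ * s * (K * (m * qv y)) := by gcongr
        _ = _ := by ring
    have y1 : 0 ≤ s * (m * W) := by positivity
    have y2 : 0 ≤ s * (m * qv y) := by positivity
    have fin : (3 * μ * K + 2 * κ * K ^ 2) * s * (m * W) + 2 * κ * K ^ 2 * s * (m * W)
        + (2 + 2 * K) * K ^ 2 * s * (m * W) + K ^ 2 * s * (m * qv y) + μ * K * s * (m * W)
        + μ * K * s * (m * qv y) ≤ Cb * s * (m * (W + qv y)) := by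
      have d1 : 0 ≤ K ^ 2 * (s * (m * W)) := by positivity
      have d2 : 0 ≤ (3 * μ * K + 4 * κ * K ^ 2 + (2 + 2 * K) * K ^ 2) * (s * (m * qv y)) := by
        positivity
      have : Cb * s * (m * (W + qv y)) = (3 * μ * K + 2 * κ * K ^ 2) * s * (m * W) + 2 * κ * K ^ 2 * s * (m * W)
        + (2 + 2 * K) * K ^ 2 * s * (m * W) + K ^ 2 * s * (m * qv y) + μ * K * s * (m * W)
        + μ * K * s * (m * qv y) + K ^ 2 * (s * (m * W))
        + (3 * μ * K + 4 * κ * K ^ 2 + (2 + 2 * K) * K ^ 2) * (s * (m * qv y)) := by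
        rw [hCb]; ring
      linarith
    have x4 : (2 + 2 * K) * (Z y * (r * W)) =
        (2 + 2 * K) * ((Real.sqrt (Z y) * r) * (Real.sqrt (Z y) * W)) := by
      linear_combination (-(2 + 2 * K) * (r * W)) * sqz
    have x8 : |Z1 y| * (|n|⁻¹ * ((r + e y + μ * ε * n ^ 2 * W) * ‖v y‖)) =
        |Z1 y| * (|n|⁻¹ * (r * ‖v y‖)) + |Z1 y| * (|n|⁻¹ * (e y * ‖v y‖))
        + |Z1 y| * (|n|⁻¹ * (μ * ε * n ^ 2 * W * ‖v y‖)) := by ring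
    rw [x8, x4, one_mul]
    linarith)
  rw [int3 i1 i2 i3, i3e, one_mul] at en
  refine en.trans ?_
  have cs1 : ∫ y in Ioi (0:ℝ), mfun ε n u v h g u1 v1 h1 g1 q y * (w4 u v h g y + qv y) ≤
      Real.sqrt (∫ y in Ioi (0:ℝ), mfun ε n u v h g u1 v1 h1 g1 q y ^ 2) *
          (3 * Real.sqrt (∫ y in Ioi (0:ℝ), w4 u v h g y ^ 2)) := by
    have j1 : IntegrableOn (fun y => mfun ε n u v h g u1 v1 h1 g1 q y * w4 u v h g y) (Ioi 0) :=
      mm.integrable_mul c.mW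
    have j2 : IntegrableOn (fun y => mfun ε n u v h g u1 v1 h1 g1 q y * qv y) (Ioi 0) :=
      mm.integrable_mul mqv
    have a1 := cs_int (Eventually.of_forall (fun y => (c.m0 y).2.2))
      (Eventually.of_forall (w4_nonneg u v h g)) mm c.mW
    have a2 := cs_int (Eventually.of_forall (fun y => (c.m0 y).2.2))
      (Eventually.of_forall qv0) mm mqv
    have a3 : Real.sqrt (∫ y in Ioi (0:ℝ), qv y ^ 2) ≤
        2 * Real.sqrt (∫ y in Ioi (0:ℝ), w4 u v h g y ^ 2) := by
      refine (Real.sqrt_le_sqrt iqv).trans (le_of_eq ?_)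
      rw [Real.sqrt_mul (by norm_num), show (4:ℝ) = 2 ^ 2 by norm_num,
        Real.sqrt_sq (by norm_num)]
    have a4 := mul_le_mul_of_nonneg_left a3
      (Real.sqrt_nonneg (∫ y in Ioi (0:ℝ), mfun ε n u v h g u1 v1 h1 g1 q y ^ 2))
    simp only [mul_add]
    rw [integral_add j1 j2]
    linarith
  have cs2 : ∫ y in Ioi (0:ℝ), (Real.sqrt (Z y) * w4 R1 R2 R3 R4 y) *
      (Real.sqrt (Z y) * w4 u v h g y) ≤
      Real.sqrt (∫ y in Ioi (0:ℝ), Z y * w4 R1 R2 R3 R4 y ^ 2) *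
          Real.sqrt (∫ y in Ioi (0:ℝ), Z y * w4 u v h g y ^ 2) := by
    have a1 := cs_int
      (Eventually.of_forall (fun y => mul_nonneg (Real.sqrt_nonneg _) (w4_nonneg R1 R2 R3 R4 y)))
      (Eventually.of_forall (fun y => mul_nonneg (Real.sqrt_nonneg _) (w4_nonneg u v h g y)))
      mZr mZw
    have ee : ∀ f : ℝ → ℝ, ∫ y in Ioi (0:ℝ), (Real.sqrt (Z y) * f y) ^ 2 =
        ∫ y in Ioi (0:ℝ), Z y * f y ^ 2 := by
      intro f
      refine setIntegral_congr_fun measurableSet_Ioi (fun y hy => ?_)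
      rw [mul_pow, Real.sq_sqrt (Z0 y (le_of_lt hy)).1]
    rwa [ee, ee] at a1
  gcongr
end

lemma num_log {ε : ℝ} (hε : 0 < ε) (h1 : ε < Real.exp (-1)) :
    1 ≤ |Real.log ε| ∧ Real.log ((2 + ε ^ 2) / ε ^ 2) ≤ 4 * |Real.log ε| ∧
      |Real.log ε| * ε ≤ 2 * Real.sqrt ε ∧ ε ≤ 1 := by
  have hl : Real.log ε < -1 := by rwa [Real.log_lt_iff_lt_exp hε]
  have ha : |Real.log ε| = -Real.log ε := abs_of_neg (by linarith)
  have he1 : ε ≤ 1 := by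
    by_contra hh
    have := Real.log_pos (not_le.1 hh)
    linarith
  refine ⟨by rw [ha]; linarith, ?_, ?_, he1⟩
  · have h3 : (2 + ε ^ 2) / ε ^ 2 ≤ 3 / ε ^ 2 := by
      gcongr; nlinarith
    have h4 := Real.log_le_log (by positivity) h3
    rw [Real.log_div (show (3:ℝ) ≠ 0 by norm_num) (by positivity), Real.log_pow] at h4
    have h5 : Real.log 3 ≤ 2 := by
      have := Real.log_le_sub_one_of_pos (show (0:ℝ) < 3 by norm_num)
      linarith
    rw [ha]; push_cast at h4; linarith
  · have h6 := Real.log_le_rpow_div (x := ε⁻¹) (ε := 1 / 2) (by positivity) (by norm_num)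
    rw [Real.log_inv, ← Real.sqrt_eq_rpow, Real.sqrt_inv, ← ha] at h6
    have hs : 0 < Real.sqrt ε := Real.sqrt_pos.2 hε
    have hs2 : Real.sqrt ε ^ 2 = ε := Real.sq_sqrt hε.le
    calc |Real.log ε| * ε ≤ (Real.sqrt ε)⁻¹ / (1 / 2) * ε := by gcongr
      _ = 2 * Real.sqrt ε := by
        nth_rw 2 [← hs2]; field_simp

lemma loc_bd {f Z : ℝ → ℝ} {K ε : ℝ} (hK : 1 ≤ K) (hε : 0 < ε) (hε1 : ε < Real.exp (-1))
    (hf0 : ∀ y, 0 ≤ f y) (hf : MemLp f 2 (volume.restrict (Ioi 0)))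
    (Zc : Continuous Z) (Z0 : ∀ y, 0 ≤ y → 0 ≤ Z y ∧ Z y ≤ K)
    (Zl : ∀ y, 0 < y → y ≤ 2 → y ≤ K * Z y) :
    (∫ y in Ioc (0:ℝ) 2, f y) ^ 2 ≤ 4 * |Real.log ε| *
      (K * (∫ y in Ioi (0:ℝ), Z y * f y ^ 2) + ε ^ 2 * ∫ y in Ioi (0:ℝ), f y ^ 2) ∧
    (∫ y in Ioi (0:ℝ), Z y * f y ^ 2) ≤ K * ∫ y in Ioi (0:ℝ), f y ^ 2 := by
  have hpos : ∀ᵐ y ∂(volume.restrict (Ioi (0:ℝ))), 0 < y := ae_restrict_mem measurableSet_Ioi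
  have i2 : IntegrableOn (fun y => f y ^ 2) (Ioi 0) := hf.integrable_sq
  have i1 : IntegrableOn (fun y => Z y * f y ^ 2) (Ioi 0) := by
    refine Integrable.bdd_mul (c := K) hf.integrable_sq Zc.aestronglyMeasurable ?_
    filter_upwards [hpos] with y hy
    rw [Real.norm_of_nonneg (Z0 y hy.le).1]; exact (Z0 y hy.le).2
  obtain ⟨l1, l2, l3, l4⟩ := num_log hε hε1
  have hδ : 0 < ε ^ 2 := by positivity
  have i3 : IntegrableOn (fun y => K * (Z y * f y ^ 2) + ε ^ 2 * f y ^ 2) (Ioi 0) :=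
    (i1.const_mul K).add (i2.const_mul _)
  constructor
  · refine (loc_l1 hf0 hf hδ).trans ?_
    have n0 : ∀ y, 0 < y → 0 ≤ K * (Z y * f y ^ 2) + ε ^ 2 * f y ^ 2 := fun y hy => by
      have := (Z0 y hy.le).1
      positivity
    have a1 : ∫ y in Ioc (0:ℝ) 2, (y + ε ^ 2) * f y ^ 2 ≤
        ∫ y in Ioc (0:ℝ) 2, (K * (Z y * f y ^ 2) + ε ^ 2 * f y ^ 2) := by
      refine integral_mono_of_nonneg ?_ (i3.mono_set Ioc_subset_Ioi_self) ?_
      · filter_upwards [ae_restrict_mem measurableSet_Ioc] with y hy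
        have := hy.1
        simp only [Pi.zero_apply]
        positivity
      · filter_upwards [ae_restrict_mem measurableSet_Ioc] with y hy
        have := mul_le_mul_of_nonneg_right (Zl y hy.1 hy.2) (sq_nonneg (f y))
        linarith
    have a2 : ∫ y in Ioc (0:ℝ) 2, (K * (Z y * f y ^ 2) + ε ^ 2 * f y ^ 2) ≤
        ∫ y in Ioi (0:ℝ), (K * (Z y * f y ^ 2) + ε ^ 2 * f y ^ 2) := by
      refine setIntegral_mono_set i3 ?_ (Ioc_subset_Ioi_self.eventuallyLE)
      filter_upwards [hpos] with y hy using n0 y hy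
    have a3 : ∫ y in Ioi (0:ℝ), (K * (Z y * f y ^ 2) + ε ^ 2 * f y ^ 2) =
        K * (∫ y in Ioi (0:ℝ), Z y * f y ^ 2) + ε ^ 2 * ∫ y in Ioi (0:ℝ), f y ^ 2 := by
      rw [integral_add (i1.const_mul K) (i2.const_mul _), integral_const_mul, integral_const_mul]
    rw [← a3]
    have a4 : 0 ≤ ∫ y in Ioc (0:ℝ) 2, (y + ε ^ 2) * f y ^ 2 := by
      refine setIntegral_nonneg measurableSet_Ioc fun y hy => ?_
      have := hy.1
      positivity
    exact mul_le_mul l2 (a1.trans a2) a4 (by positivity)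
  · rw [← integral_const_mul]
    refine integral_mono_ae i1 (i2.const_mul K) ?_
    filter_upwards [hpos] with y hy
    exact mul_le_mul_of_nonneg_right (Z0 y hy.le).2 (sq_nonneg _)

lemma num_half {K L A W I ε : ℝ} (hK : 1 ≤ K) (hL : 1 ≤ L) (hε : 0 < ε)
    (hA : 0 ≤ A) (hW : 0 ≤ W) (hI : I ^ 2 ≤ 4 * L * (K * A ^ 2 + ε ^ 2 * W ^ 2)) :
    I ≤ 2 * Real.sqrt L * (K * A + ε * W) := by
  refine le_of_sq_le_sq ?_ (by positivity)
  refine hI.trans ?_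
  rw [mul_pow, mul_pow, Real.sq_sqrt (by linarith)]
  have : K * A ^ 2 + ε ^ 2 * W ^ 2 ≤ (K * A + ε * W) ^ 2 := by
    have : K * A ^ 2 ≤ K ^ 2 * A ^ 2 := by
      gcongr; nlinarith
    have : 0 ≤ K * A * (ε * W) := by positivity
    nlinarith
  calc _ ≤ 4 * L * (K * A + ε * W) ^ 2 := by gcongr
    _ = _ := by norm_num

lemma num_core {K c1 D ε s N L P A RZ Rn Wn M I Ir a1 a2 : ℝ} (hK : 1 ≤ K)
    (hD : 0 ≤ D) (hε : 0 < ε) (hs : 0 < s) (hs1 : s ≤ 1) (hs2 : s ^ 2 = ε) (hN : 0 < N)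
    (hL : 1 ≤ L) (hLe : L * ε ≤ 2 * s) (ha1 : 0 ≤ a1) (ha2 : 0 ≤ a2)
    (hA : 0 ≤ A) (hRZ : 0 ≤ RZ) (hRn : 0 ≤ Rn) (hWn : 0 ≤ Wn)
    (hIr0 : 0 ≤ Ir) (hI0 : 0 ≤ I)
    (h1 : c1 * ε * (P ^ 2 + N ^ 2 * A ^ 2) ≤ a1 * s * (M * (3 * Wn)) + a2 * (RZ * A)
      + (K * (Ir * I) + 2 * K ^ 2 * (N * I ^ 2)))
    (hI : I ^ 2 ≤ 4 * L * (K * A ^ 2 + ε ^ 2 * Wn ^ 2))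
    (hIr : Ir ^ 2 ≤ 4 * L * (K * RZ ^ 2 + ε ^ 2 * Rn ^ 2))
    (hM : M ^ 2 ≤ D * (Rn * Wn + Wn ^ 2)) (hsN : s * N * Wn ≤ M)
    (hAW : A ≤ K * Wn) (hRR : RZ ≤ K * Rn) :
    c1 * ε * (P ^ 2 + N ^ 2 * A ^ 2) ≤
      (3 * a1 * (D + 1) + 8 * K * (2 * K ^ 2 + 1) + 8 * K ^ 2 * (D + 1) + a2 + 12 * K ^ 3) *
       (L * (RZ * A + N * A ^ 2) + s * (Rn * Wn + Wn ^ 2)) := by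
  have hK0 : 0 < K := by linarith
  have hL0 : 0 < L := by linarith
  have hε1 : ε ≤ 1 := by nlinarith
  set J := Rn * Wn + Wn ^ 2 with hJ
  have hRW : 0 ≤ Rn * Wn := by positivity
  have hJ0 : 0 ≤ J := by positivity
  have hRA : 0 ≤ RZ * A := by positivity
  have hNA : 0 ≤ N * A ^ 2 := by positivity
  have b1 : M * Wn ≤ (D + 1) / 2 * J := by nlinarith [sq_nonneg (M - Wn)]
  have b2 : Ir * I ≤ 4 * L * ((K * RZ + ε * Rn) * (K * A + ε * Wn)) := by
    have x1 := num_half hK hL hε hA hWn hI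
    have x2 := num_half hK hL hε hRZ hRn hIr
    calc Ir * I ≤ (2 * Real.sqrt L * (K * RZ + ε * Rn)) * (2 * Real.sqrt L * (K * A + ε * Wn)) := by
          gcongr
      _ = 4 * Real.sqrt L ^ 2 * ((K * RZ + ε * Rn) * (K * A + ε * Wn)) := by ring
      _ = _ := by rw [Real.sq_sqrt hL0.le]
  have b3 : (K * RZ + ε * Rn) * (K * A + ε * Wn) ≤
      K ^ 2 * (RZ * A) + ε * ((2 * K ^ 2 + 1) * (Rn * Wn)) := by
    have y1 : K * RZ * Wn ≤ K ^ 2 * (Rn * Wn) := by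
      calc K * RZ * Wn ≤ K * (K * Rn) * Wn := by gcongr
        _ = _ := by ring
    have y2 : K * Rn * A ≤ K ^ 2 * (Rn * Wn) := by
      calc K * Rn * A ≤ K * Rn * (K * Wn) := by gcongr
        _ = _ := by ring
    have y3 : ε * (Rn * Wn) ≤ 1 * (Rn * Wn) := by gcongr
    have y4 : ε * (K * RZ * Wn + K * Rn * A + ε * (Rn * Wn)) ≤
        ε * ((2 * K ^ 2 + 1) * (Rn * Wn)) := by
      gcongr; linarith
    have y5 : (K * RZ + ε * Rn) * (K * A + ε * Wn) = K ^ 2 * (RZ * A) +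
        ε * (K * RZ * Wn + K * Rn * A + ε * (Rn * Wn)) := by ring
    rw [y5]; linarith
  have b4 : Ir * I ≤ 4 * K ^ 2 * (L * (RZ * A)) + 8 * (2 * K ^ 2 + 1) * (s * J) := by
    have y5 : L * ε * ((2 * K ^ 2 + 1) * (Rn * Wn)) ≤ 2 * s * ((2 * K ^ 2 + 1) * J) := by
      gcongr
      rw [hJ]; linarith [sq_nonneg Wn]
    have := mul_le_mul_of_nonneg_left b3 (show 0 ≤ 4 * L by positivity)
    linarith
  have b5 : N * I ^ 2 ≤ 4 * K * (L * (N * A ^ 2)) + 4 * (D + 1) * (s * J) := by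
    have z1 := mul_le_mul_of_nonneg_left hI hN.le
    have z2 : s * (s * N * Wn) * Wn ≤ M * Wn := by
      have : 0 ≤ s * N * Wn := by positivity
      gcongr
      exact (mul_le_of_le_one_left this hs1).trans hsN
    have z3 : L * ε * (ε * N * Wn ^ 2) ≤ 2 * s * ((D + 1) / 2 * J) := by
      refine mul_le_mul hLe ?_ (by positivity) (by positivity)
      refine le_trans (le_of_eq ?_) (z2.trans b1)
      rw [← hs2]; ring
    linarith
  have b6 : RZ * A ≤ L * (RZ * A) := le_mul_of_one_le_left hRA hL
  have hLRA : 0 ≤ L * (RZ * A) := by positivity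
  have hLNA : 0 ≤ L * (N * A ^ 2) := by positivity
  have hsJ : 0 ≤ s * J := by positivity
  have t1 : a1 * s * (M * (3 * Wn)) ≤ (3 * a1 * (D + 1)) * (s * J) := by
    have := mul_le_mul_of_nonneg_left b1 (show 0 ≤ 3 * a1 * s by positivity)
    have q : 0 ≤ a1 * s * (D + 1) * J := by positivity
    linarith
  have t2 : a2 * (RZ * A) ≤ a2 * (L * (RZ * A)) := by gcongr
  have t3 := mul_le_mul_of_nonneg_left b4 hK0.le
  have t4 := mul_le_mul_of_nonneg_left b5 (show 0 ≤ 2 * K ^ 2 by positivity)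
  set X := L * (RZ * A)
  set Y := L * (N * A ^ 2)
  set T := s * J
  have e : L * (RZ * A + N * A ^ 2) = X + Y := by ring
  rw [e]
  have c0 : 0 ≤ 3 * a1 * (D + 1) := by positivity
  have c2 : 0 ≤ K * (2 * K ^ 2 + 1) := by positivity
  have c3 : 0 ≤ K ^ 2 * (D + 1) := by positivity
  have c4 : 0 ≤ K ^ 3 := by positivity
  have F1 := mul_nonneg c0 hLRA
  have F2 := mul_nonneg c0 hLNA
  have F3 := mul_nonneg c2 hLRA
  have F4 := mul_nonneg c2 hLNA
  have F5 := mul_nonneg c3 hLRA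
  have F6 := mul_nonneg c3 hLNA
  have F7 := mul_nonneg c4 hLRA
  have F8 := mul_nonneg c4 hLNA
  have F9 := mul_nonneg c4 hsJ
  have F10 := mul_nonneg ha2 hLNA
  have F11 := mul_nonneg ha2 hsJ
  linarith

lemma num_final {c1 Cf ε s N L P A RZ Rn Wn η : ℝ} (hc1 : 0 < c1) (hCf : 0 ≤ Cf)
    (hε : 0 < ε) (hs : s = Real.sqrt ε) (hN : 0 < N) (hL : 1 ≤ L) (hη : 0 < η)
    (hA : 0 ≤ A) (hRZ : 0 ≤ RZ) (hRn : 0 ≤ Rn) (hWn : 0 ≤ Wn)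
    (h : c1 * ε * (P ^ 2 + N ^ 2 * A ^ 2) ≤
      Cf * (L * (RZ * A + N * A ^ 2) + s * (Rn * Wn + Wn ^ 2))) :
    s * (P + N * A) ≤ Real.sqrt (2 * Cf / c1) * L ^ ((1:ℝ)/2 + η/6) *
        ((Real.sqrt N)⁻¹ * RZ + Real.sqrt N * A)
      + Real.sqrt (2 * Cf / c1) * ε ^ ((1:ℝ)/4) * (Wn + Real.sqrt Wn * Real.sqrt Rn) := by
  have hs2 : s ^ 2 = ε := by rw [hs]; exact Real.sq_sqrt hε.le
  set r := ε ^ ((1:ℝ)/4) with hr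
  have hr0 : 0 < r := by positivity
  have hr2 : r ^ 2 = s := by
    rw [hs, hr, Real.sqrt_eq_rpow, ← Real.rpow_natCast, ← Real.rpow_mul hε.le]; norm_num
  have hsN : 0 < Real.sqrt N := Real.sqrt_pos.2 hN
  have hsN2 : Real.sqrt N ^ 2 = N := Real.sq_sqrt hN.le
  set α := (Real.sqrt N)⁻¹ * RZ with hα
  set β := Real.sqrt N * A with hβ
  have hα0 : 0 ≤ α := by positivity
  have hβ0 : 0 ≤ β := by positivity
  have hαβ : RZ * A = α * β := by rw [hα, hβ]; field_simp
  have hββ : N * A ^ 2 = β ^ 2 := by rw [hβ, mul_pow, hsN2]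
  have hL0 : 0 < L := by linarith
  set l := Real.sqrt L with hl
  have hl2 : l ^ 2 = L := Real.sq_sqrt hL0.le
  have hl0 : 0 ≤ l := Real.sqrt_nonneg _
  have hll : l ≤ L ^ ((1:ℝ)/2 + η/6) := by
    rw [hl, Real.sqrt_eq_rpow]
    exact Real.rpow_le_rpow_of_exponent_le hL (by linarith)
  set T := Wn + Real.sqrt Wn * Real.sqrt Rn with hT
  have hw := Real.sqrt_nonneg Wn
  have hrn := Real.sqrt_nonneg Rn
  have hT0 : 0 ≤ T := by positivity
  have hJT : Rn * Wn + Wn ^ 2 ≤ T ^ 2 := by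
    have : T ^ 2 = Wn ^ 2 + Rn * Wn + 2 * (Wn * (Real.sqrt Wn * Real.sqrt Rn)) := by
      rw [hT]
      have e1 := Real.sq_sqrt hWn
      have e2 := Real.sq_sqrt hRn
      calc _ = Wn ^ 2 + Real.sqrt Rn ^ 2 * Real.sqrt Wn ^ 2
            + 2 * (Wn * (Real.sqrt Wn * Real.sqrt Rn)) := by ring
        _ = _ := by rw [e1, e2]
    have : 0 ≤ Wn * (Real.sqrt Wn * Real.sqrt Rn) := by positivity
    linarith
  set C := Real.sqrt (2 * Cf / c1) with hC
  have hC0 : 0 ≤ C := Real.sqrt_nonneg _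
  have hC2 : C ^ 2 = 2 * Cf / c1 := Real.sq_sqrt (by positivity)
  have key : s * (P + N * A) ≤ C * (l * (α + β) + r * T) := by
    refine le_of_sq_le_sq ?_ (by positivity)
    have k1 : (s * (P + N * A)) ^ 2 ≤ 2 * (ε * (P ^ 2 + N ^ 2 * A ^ 2)) := by
      rw [mul_pow, hs2]
      linarith [mul_nonneg hε.le (sq_nonneg (P - N * A))]
    have k2 : L * (RZ * A + N * A ^ 2) + s * (Rn * Wn + Wn ^ 2) ≤ (l * (α + β) + r * T) ^ 2 := by
      rw [hαβ, hββ]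
      have m1 : L * (α * β + β ^ 2) ≤ L * (α + β) ^ 2 := by
        gcongr; linarith [mul_nonneg hα0 hβ0, add_sq α β, sq_nonneg α]
      have m2 : s * (Rn * Wn + Wn ^ 2) ≤ r ^ 2 * T ^ 2 := by
        rw [hr2]; gcongr; rw [← hr2]; positivity
      have m3 : 0 ≤ l * (α + β) * (r * T) := by positivity
      have m4 : (l * (α + β) + r * T) ^ 2 = l ^ 2 * (α + β) ^ 2 + r ^ 2 * T ^ 2
        + 2 * (l * (α + β) * (r * T)) := by ring
      rw [m4, hl2]
      linarith
    have k3 : ε * (P ^ 2 + N ^ 2 * A ^ 2) ≤ Cf / c1 * (l * (α + β) + r * T) ^ 2 := by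
      rw [div_mul_eq_mul_div, le_div_iff₀ hc1]
      calc _ = c1 * ε * (P ^ 2 + N ^ 2 * A ^ 2) := by ring
        _ ≤ _ := h
        _ ≤ _ := by gcongr
    rw [mul_pow C, hC2]
    calc _ ≤ _ := k1
      _ ≤ 2 * (Cf / c1 * (l * (α + β) + r * T) ^ 2) := by gcongr
      _ = _ := by ring
  refine key.trans ?_
  have : C * (l * (α + β)) ≤ C * (L ^ ((1:ℝ)/2 + η/6) * (α + β)) := by gcongr
  linarith

/-- the constant of the weighted estimate -/
def Cfin (μ κ γ₀ K : ℝ) : ℝ :=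
  3 * (4 * μ * K + 4 * κ * K ^ 2 + (3 + 2 * K) * K ^ 2) * (CJ μ κ γ₀ K + 1)
    + 8 * K * (2 * K ^ 2 + 1) + 8 * K ^ 2 * (CJ μ κ γ₀ K + 1) + (2 + 2 * K) + 12 * K ^ 3

section
variable {μ κ γ₀ K ε n : ℝ} {cu G G1 e q : ℝ → ℝ}
    {u v h g u1 v1 h1 g1 u2 v2 h2 g2 p p1 E1 E2 E3 E4 R1 R2 R3 R4 : ℝ → ℂ}

lemma Core.final (c : Core μ κ γ₀ K ε n cu G G1 e q
      u v h g u1 v1 h1 g1 u2 v2 h2 g2 p p1 E1 E2 E3 E4 R1 R2 R3 R4)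
    (hε1 : ε < Real.exp (-1)) {η : ℝ} (hη : 0 < η)
    {Z Z1 Z2 : ℝ → ℝ} (dZ : ∀ y, HasDerivAt Z (Z1 y) y) (dZ1 : ∀ y, HasDerivAt Z1 (Z2 y) y)
    (Z0 : ∀ y, 0 ≤ y → 0 ≤ Z y ∧ Z y ≤ K) (Zy : ∀ y, 0 ≤ y → Z y ≤ K * y)
    (Zl : ∀ y, 0 < y → y ≤ 2 → y ≤ K * Z y)
    (Z1b : ∀ y, 0 ≤ y → |Z1 y| ≤ K) (Z1z : ∀ y, 2 < y → Z1 y = 0)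
    (Z2b : ∀ y, 0 ≤ y → y * |Z2 y| ≤ K) :
    Real.sqrt ε * (Real.sqrt (∫ y in Ioi (0:ℝ), Z y * w4 u1 v1 h1 g1 y ^ 2)
      + |n| * Real.sqrt (∫ y in Ioi (0:ℝ), Z y * w4 u v h g y ^ 2)) ≤
    Real.sqrt (2 * Cfin μ κ γ₀ K / min μ (κ * γ₀)) * |Real.log ε| ^ ((1:ℝ)/2 + η/6) *
        ((Real.sqrt |n|)⁻¹ * Real.sqrt (∫ y in Ioi (0:ℝ), Z y * w4 R1 R2 R3 R4 y ^ 2)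
          + Real.sqrt |n| * Real.sqrt (∫ y in Ioi (0:ℝ), Z y * w4 u v h g y ^ 2))
      + Real.sqrt (2 * Cfin μ κ γ₀ K / min μ (κ * γ₀)) * ε ^ ((1:ℝ)/4) *
        (Real.sqrt (∫ y in Ioi (0:ℝ), w4 u v h g y ^ 2)
          + Real.sqrt (Real.sqrt (∫ y in Ioi (0:ℝ), w4 u v h g y ^ 2)) *
            Real.sqrt (Real.sqrt (∫ y in Ioi (0:ℝ), w4 R1 R2 R3 R4 y ^ 2))) := by
  have hμ := c.hμ
  have hκ := c.hκ
  have hγ := c.hγ₀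
  have hK := c.hK
  have hK0 : 0 < K := by linarith
  have hε := c.hε
  have hn : 0 < |n| := abs_pos.2 c.hn
  have Zc : Continuous Z := continuous_iff_continuousAt.2 fun y => (dZ y).continuousAt
  have hs0 : 0 < Real.sqrt ε := Real.sqrt_pos.2 hε
  obtain ⟨l1, l2, l3, l4⟩ := num_log hε hε1
  have hc1 : 0 < min μ (κ * γ₀) := lt_min hμ (mul_pos hκ hγ)
  have hCJ : 0 ≤ CJ μ κ γ₀ K := by unfold CJ; positivity
  have hCf : 0 ≤ Cfin μ κ γ₀ K := by unfold Cfin; positivity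
  have nn : ∀ f : ℝ → ℝ, 0 ≤ ∫ y in Ioi (0:ℝ), f y ^ 2 := fun f =>
    integral_nonneg fun y => sq_nonneg _
  have nZ : ∀ f : ℝ → ℝ, 0 ≤ ∫ y in Ioi (0:ℝ), Z y * f y ^ 2 := fun f =>
    setIntegral_nonneg measurableSet_Ioi fun y hy => mul_nonneg (Z0 y (le_of_lt hy)).1 (sq_nonneg _)
  have n2 : ∀ f : ℝ → ℝ, (∀ y, 0 ≤ f y) → 0 ≤ ∫ y in Ioc (0:ℝ) 2, f y := fun f hf =>
    integral_nonneg hf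
  obtain ⟨w1, w2⟩ := loc_bd hK hε hε1 (w4_nonneg u v h g) c.mW Zc Z0 Zl
  obtain ⟨r1, r2⟩ := loc_bd hK hε hε1 (w4_nonneg R1 R2 R3 R4) c.mR Zc Z0 Zl
  have hun := c.unweighted
  have hwe := c.weighted dZ dZ1 Z0 Zy Z1b Z1z Z2b
  have sq : ∀ {x : ℝ}, 0 ≤ x → Real.sqrt x ^ 2 = x := fun hx => Real.sq_sqrt hx
  have le' : ∀ {x y : ℝ}, 0 ≤ y → x ≤ K * y → Real.sqrt x ≤ K * Real.sqrt y := by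
    intro x y hy hxy
    rw [Real.sqrt_le_left (by positivity), mul_pow, sq hy]
    refine hxy.trans ?_
    gcongr
    nlinarith
  refine num_final hc1 hCf hε rfl hn l1 hη (Real.sqrt_nonneg _) (Real.sqrt_nonneg _)
    (Real.sqrt_nonneg _) (Real.sqrt_nonneg _) ?_
  refine num_core (a1 := 4 * μ * K + 4 * κ * K ^ 2 + (3 + 2 * K) * K ^ 2) (a2 := 2 + 2 * K)
    (D := CJ μ κ γ₀ K)
    (M := Real.sqrt (∫ y in Ioi (0:ℝ), mfun ε n u v h g u1 v1 h1 g1 q y ^ 2))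
    (I := ∫ y in Ioc (0:ℝ) 2, w4 u v h g y) (Ir := ∫ y in Ioc (0:ℝ) 2, w4 R1 R2 R3 R4 y)
    hK hCJ hε hs0 (Real.sqrt_le_one.2 l4) (sq hε.le) hn l1 l3 (by positivity) (by positivity)
    (Real.sqrt_nonneg _) (Real.sqrt_nonneg _)
    (Real.sqrt_nonneg _) (Real.sqrt_nonneg _) (n2 _ (w4_nonneg _ _ _ _)) (n2 _ (w4_nonneg _ _ _ _))
    ?_ ?_ ?_ ?_ ?_ (le' (nn _) w2) (le' (nn _) r2)
  · rw [sq (nZ _), sq (nZ _), sq_abs]; exact hwe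
  · rw [sq (nZ _), sq (nn _)]; exact w1
  · rw [sq (nZ _), sq (nn _)]; exact r1
  · rw [sq (nn _)]; exact hun
  · refine Real.le_sqrt_of_sq_le ?_
    rw [mul_pow, sq (nn _), ← integral_const_mul]
    refine integral_mono (c.mW.integrable_sq.const_mul _) c.mm.integrable_sq ?_
    intro y
    obtain ⟨m1, m2, m3⟩ := c.m0 y
    have := w4_nonneg u v h g y
    have z : 0 ≤ Real.sqrt ε * |n| * w4 u v h g y := by positivity
    calc _ = (Real.sqrt ε * |n| * w4 u v h g y) ^ 2 := by ring
      _ ≤ _ := pow_le_pow_left₀ z m1 2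
end

lemma w4_mem {a b c d : ℝ → ℂ} (ha : ML2 a) (hb : ML2 b) (hc : ML2 c) (hd : ML2 d)
    (ma : AEStronglyMeasurable a (volume.restrict (Ioi 0)))
    (mb : AEStronglyMeasurable b (volume.restrict (Ioi 0)))
    (mc : AEStronglyMeasurable c (volume.restrict (Ioi 0)))
    (md : AEStronglyMeasurable d (volume.restrict (Ioi 0))) :
    MemLp (w4 a b c d) 2 (volume.restrict (Ioi 0)) := by
  have hm : AEStronglyMeasurable (w4 a b c d) (volume.restrict (Ioi 0)) := by
    unfold w4
    exact Real.continuous_sqrt.comp_aestronglyMeasurable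
      ((((ma.norm.pow 2).add (mb.norm.pow 2)).add (mc.norm.pow 2)).add (md.norm.pow 2))
  rw [memLp_two_iff_integrable_sq hm]
  simp only [w4_sq]
  exact ((ha.add hb).add hc).add hd

lemma nrm4_eq {a b c d : ℝ → ℂ} (ha : ML2 a) (hb : ML2 b) (hc : ML2 c) (hd : ML2 d) :
    nrm4 a b c d = Real.sqrt (∫ y in Ioi (0:ℝ), w4 a b c d y ^ 2) := by
  unfold nrm4 nsq
  simp only [w4_sq]
  congr 1
  have h1 : Integrable (fun y => ‖a y‖ ^ 2 + ‖b y‖ ^ 2) (volume.restrict (Ioi 0)) := ha.add hb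
  have h2 : Integrable (fun y => ‖a y‖ ^ 2 + ‖b y‖ ^ 2 + ‖c y‖ ^ 2) (volume.restrict (Ioi 0)) :=
    h1.add hc
  rw [integral_add h2 hd, integral_add h1 hc, integral_add ha hb]

lemma wt_norm {Z : ℝ → ℝ} {f : ℝ → ℂ} {y : ℝ} (h : 0 ≤ Z y) :
    ‖wt Z f y‖ ^ 2 = Z y * ‖f y‖ ^ 2 := by
  unfold wt
  rw [norm_mul, mul_pow, Complex.norm_real, Real.norm_of_nonneg (Real.sqrt_nonneg _),
    Real.sq_sqrt h]

lemma wt_ML2 {Z : ℝ → ℝ} {K : ℝ} (Zc : Continuous Z) (Z0 : ∀ y, 0 ≤ y → 0 ≤ Z y ∧ Z y ≤ K)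
    {f : ℝ → ℂ} (hf : ML2 f) : ML2 (wt Z f) := by
  have hpos : ∀ᵐ y ∂(volume.restrict (Ioi (0:ℝ))), 0 < y := ae_restrict_mem measurableSet_Ioi
  have i1 : IntegrableOn (fun y => Z y * ‖f y‖ ^ 2) (Ioi 0) := by
    refine Integrable.bdd_mul (c := K) hf Zc.aestronglyMeasurable ?_
    filter_upwards [hpos] with y hy
    rw [Real.norm_of_nonneg (Z0 y hy.le).1]; exact (Z0 y hy.le).2
  refine Integrable.congr i1 ?_
  filter_upwards [hpos] with y hy
  exact (wt_norm (Z0 y hy.le).1).symm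

lemma nrm4_wt {Z : ℝ → ℝ} {K : ℝ} (Zc : Continuous Z) (Z0 : ∀ y, 0 ≤ y → 0 ≤ Z y ∧ Z y ≤ K)
    {a b c d : ℝ → ℂ} (ha : ML2 a) (hb : ML2 b) (hc : ML2 c) (hd : ML2 d) :
    nrm4 (wt Z a) (wt Z b) (wt Z c) (wt Z d) =
      Real.sqrt (∫ y in Ioi (0:ℝ), Z y * w4 a b c d y ^ 2) := by
  rw [nrm4_eq (wt_ML2 Zc Z0 ha) (wt_ML2 Zc Z0 hb) (wt_ML2 Zc Z0 hc) (wt_ML2 Zc Z0 hd)]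
  congr 1
  refine setIntegral_congr_fun measurableSet_Ioi fun y hy => ?_
  have h0 := (Z0 y (le_of_lt hy)).1
  simp only [w4_sq, wt_norm h0]
  ring

lemma term_bd {a A0 A1 B0 B1 C0 C1 D h g h1 g1 ψ : ℂ} {s N t y q w w1 Ka : ℝ}
    (hs : 0 < s) (hN : 0 ≤ N) (hy : 0 < y) (ht : t = 1 + y / s) (hK : 0 ≤ Ka)
    (ha : ‖a‖ ≤ s * N) (hA0 : t * ‖A0‖ ≤ Ka) (hA1 : t * ‖A1‖ ≤ Ka)
    (hB0 : t * ‖B0‖ ≤ Ka) (hB1 : t * ‖B1‖ ≤ Ka)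
    (hC0 : t * ‖C0‖ ≤ Ka) (hC1 : t * ‖C1‖ ≤ Ka) (hD : t ^ 2 * ‖D‖ ≤ Ka)
    (hh : ‖h‖ ≤ w) (hg : ‖g‖ ≤ w) (hh1 : ‖h1‖ ≤ w1) (hg1 : ‖g1‖ ≤ w1) (hψ : ‖ψ‖ = y * q)
    (hq : 0 ≤ q) :
    ‖a * (A0 * h + A1 * g) + (s:ℂ) * (B0 * h1 + B1 * g1) + (C0 * h + C1 * g)
      + ((s⁻¹ : ℝ):ℂ) * ψ * D‖ ≤ 2 * Ka * ((s * N + 1) * w + s * w1 + q) / t := by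
  have ht0 : 0 < t := by rw [ht]; positivity
  have hw : 0 ≤ w := (norm_nonneg _).trans hh
  have hw1 : 0 ≤ w1 := (norm_nonneg _).trans hh1
  have pr : ∀ {X0 X1 x0 x1 : ℂ} {b : ℝ}, t * ‖X0‖ ≤ Ka → t * ‖X1‖ ≤ Ka → ‖x0‖ ≤ b → ‖x1‖ ≤ b →
      t * ‖X0 * x0 + X1 * x1‖ ≤ 2 * Ka * b := by
    intro X0 X1 x0 x1 b e0 e1 f0 f1
    calc t * ‖X0 * x0 + X1 * x1‖ ≤ t * (‖X0‖ * ‖x0‖ + ‖X1‖ * ‖x1‖) := by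
          gcongr
          exact (norm_add_le _ _).trans (by rw [norm_mul, norm_mul])
      _ = (t * ‖X0‖) * ‖x0‖ + (t * ‖X1‖) * ‖x1‖ := by ring
      _ ≤ Ka * b + Ka * b := by gcongr
      _ = _ := by ring
  have hA := pr hA0 hA1 hh hg
  have hB := pr hB0 hB1 hh1 hg1
  have hC := pr hC0 hC1 hh hg
  have hDD : t * ‖((s⁻¹ : ℝ):ℂ) * ψ * D‖ ≤ Ka * q := by
    rw [norm_mul, norm_mul, hψ, Complex.norm_real, Real.norm_of_nonneg (by positivity)]
    have h1 : y / s ≤ t := by rw [ht]; linarith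
    calc t * (s⁻¹ * (y * q) * ‖D‖) = (y / s) * (t * ‖D‖) * q := by field_simp
      _ ≤ t * (t * ‖D‖) * q := by gcongr
      _ = (t ^ 2 * ‖D‖) * q := by ring
      _ ≤ Ka * q := by gcongr
  rw [le_div_iff₀ ht0]
  have n1 : ‖a * (A0 * h + A1 * g)‖ * t ≤ s * N * (2 * Ka * w) := by
    rw [norm_mul, mul_assoc, mul_comm _ t]
    gcongr
  have n2 : ‖(s:ℂ) * (B0 * h1 + B1 * g1)‖ * t ≤ s * (2 * Ka * w1) := by
    rw [norm_mul, mul_assoc, mul_comm _ t, Complex.norm_real, Real.norm_of_nonneg hs.le]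
    gcongr
  calc _ ≤ (‖a * (A0 * h + A1 * g)‖ + ‖(s:ℂ) * (B0 * h1 + B1 * g1)‖ + ‖C0 * h + C1 * g‖
      + ‖((s⁻¹ : ℝ):ℂ) * ψ * D‖) * t := by
        gcongr
        exact (norm_add_le _ _).trans (add_le_add ((norm_add_le _ _).trans
          (add_le_add (norm_add_le _ _) le_rfl)) le_rfl)
    _ ≤ 2 * Ka * ((s * N + 1) * w + s * w1 + q) := by
        have : 0 ≤ Ka * q := by positivity
        linarith

lemma meas1 {N s m σ : ℂ} {cc G : ℝ → ℝ} {a0 a1 b0 b1 c0 c1 d ψ u w h g h1 g1 p u2 : ℝ → ℂ}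
    (hcc : Measurable cc) (hG : Measurable G) (ha0 : Measurable a0) (ha1 : Measurable a1)
    (hb0 : Measurable b0) (hb1 : Measurable b1) (hc0 : Measurable c0) (hc1 : Measurable c1)
    (hd : Measurable d) (hψ : Measurable ψ) (hu : Measurable u) (hw : Measurable w)
    (hh : Measurable h) (hg : Measurable g) (hh1 : Measurable h1) (hg1 : Measurable g1)
    (hp : Measurable p) (hu2 : Measurable u2) :
    Measurable (fun y => Complex.I * N * ((cc y : ℂ) * u y - (G y : ℂ) * w y
        + s * (a0 y * h y + a1 y * g y))
      + s * (b0 y * h1 y + b1 y * g1 y) + (c0 y * h y + c1 y * g y) + σ * ψ y * d y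
      + p y - m * (u2 y - N ^ 2 * u y)) := by
  fun_prop

lemma meas2 {N m σ : ℂ} {b : ℝ → ℝ} {c0 c1 d ψ u w h g h1 h2 : ℝ → ℂ}
    (hb : Measurable b) (hc0 : Measurable c0) (hc1 : Measurable c1)
    (hd : Measurable d) (hψ : Measurable ψ) (hu : Measurable u) (hw : Measurable w)
    (hh : Measurable h) (hg : Measurable g) (hh1 : Measurable h1) (hh2 : Measurable h2) :
    Measurable (fun y => -(Complex.I * N) * u y - (b y : ℂ) * h1 y + (c0 y * h y + c1 y * g y)
      + σ * ψ y * d y - m * (h2 y - N ^ 2 * w y)) := by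
  fun_prop

set_option maxHeartbeats 4000000 in
/-- the weighted estimate on the full derivatives
`√ε(‖Z^{1/2}∂_yŴ‖ + |ñ|‖Z^{1/2}Ŵ‖)` for solutions of the transformed
linearized MHD system on one Fourier mode. -/
theorem stmt18
    (μ κ γ γbar γ₀ C₀ : ℝ) (hμ : 0 < μ) (hκ : 0 < κ)
    (hγ : 0 < γ) (hγγ : γ ≤ γbar) (hγ₀ : 0 < γ₀) (hC₀ : 1 ≤ C₀) :
    ∀ η : ℝ, 0 < η → ∀ ϱ : ℝ, 0 < ϱ → ∀ Mbar : ℝ,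
    ∃ ε₁ C : ℝ, 0 < ε₁ ∧ 0 < C ∧
    ∀ (ε : ℝ) (n : ℤ), ε ∈ Set.Ioc (0:ℝ) 1 → ε < ε₁ → n ≠ 0 →
    ∀ Us Hs : ℝ → ℝ, ContDiff ℝ 3 Us → ContDiff ℝ 3 Hs → Us 0 = 0 →
      (∀ Y, 0 ≤ Y → γ ≤ |Hs Y| ∧ |Hs Y| ≤ γbar) →
      (∀ Y, 0 ≤ Y → γ₀ ≤ Hs Y ^ 2 - Us Y ^ 2) →
      (∀ Y, 0 ≤ Y → ∀ k : ℕ, 1 ≤ k → k ≤ 3 →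
        (1 + Y)^3 * (|iteratedDeriv k Us Y| + |iteratedDeriv k Hs Y|) ≤ Mbar) →
    ∀ (AU BU CU CH : ℝ → Matrix (Fin 2) (Fin 2) ℂ) (DU DH : ℝ → Fin 2 → ℂ),
      Continuous AU → Continuous BU → Continuous CU → Continuous CH →
      Continuous DU → Continuous DH →
      (∀ Y, 0 ≤ Y → ∀ i j, (1 + Y) * (‖AU Y i j‖ + ‖BU Y i j‖) ≤ Mbar) →
      (∀ Y, 0 ≤ Y → ∀ i j, (1 + Y) * (‖CU Y i j‖ + ‖CH Y i j‖) ≤ Mbar * (1 + Mbar)) →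
      (∀ Y, 0 ≤ Y → ∀ i, (1 + Y)^2 * (‖DU Y i‖ + ‖DH Y i‖) ≤ Mbar * (1 + Mbar)) →
    ∀ Z : ℝ → ℝ, ContDiff ℝ 2 Z →
      (∀ y, 0 ≤ y → 0 ≤ Z y ∧ Z y ≤ C₀ ∧ 0 ≤ deriv Z y) →
      (∀ y ∈ Set.Icc (0:ℝ) 2, C₀⁻¹ * y ≤ Z y ∧ Z y ≤ C₀ * y) →
      (∀ y, 2 ≤ y → Z y = Z 2) →
      (∀ y ∈ Set.Icc (0:ℝ) 1,
        (Hs (y / Real.sqrt ε) ^ 2 - Us (y / Real.sqrt ε) ^ 2) * deriv Z y = 1) →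
      (∀ y ∈ Set.Icc (0:ℝ) (3/2), ∀ k : ℕ, k ≤ 3 →
        |y ^ k * deriv (deriv Z) y| ≤ C₀ * Mbar * ε ^ (((k:ℝ) - 1)/2)) →
      (∀ y, 1 ≤ y → -(C₀ * Mbar * ε) ≤
        -(deriv (fun t => (Hs (t / Real.sqrt ε) ^ 2 - Us (t / Real.sqrt ε) ^ 2)
            * deriv Z t) y)) →
      (∀ y, 3/2 ≤ y → deriv (deriv Z) y ≤ 0) →
      (∀ y, 0 ≤ y → (1 + y) * |deriv Z y| ≤ C₀ ∧
        y * |deriv (deriv Z) y| ≤ C₀ * (Mbar + 1)) →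
    ∀ u v h g p R1 R2 R3 R4 : ℝ → ℂ,
      ContDiff ℝ 3 u → ContDiff ℝ 3 v → ContDiff ℝ 3 h → ContDiff ℝ 3 g →
      ContDiff ℝ 2 p →
      (ML2 u ∧ ML2 v ∧ ML2 h ∧ ML2 g) →
      (ML2 (deriv u) ∧ ML2 (deriv v) ∧ ML2 (deriv h) ∧ ML2 (deriv g)) →
      (ML2 (deriv (deriv u)) ∧ ML2 (deriv (deriv v)) ∧
        ML2 (deriv (deriv h)) ∧ ML2 (deriv (deriv g))) →
      Tendsto (fun y => ‖u y‖ + ‖v y‖ + ‖h y‖ + ‖g y‖) atTop (nhds 0) →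
      Tendsto (fun y => ‖deriv u y‖ + ‖deriv v y‖ + ‖deriv h y‖ + ‖deriv g y‖)
        atTop (nhds 0) →
      Tendsto (fun y => ‖deriv (deriv u) y‖ + ‖deriv (deriv v) y‖
        + ‖deriv (deriv h) y‖ + ‖deriv (deriv g) y‖) atTop (nhds 0) →
      Tendsto (fun y => ‖p y‖ * (‖u y‖ + ‖v y‖ + ‖h y‖ + ‖g y‖)) atTop (nhds 0) →
      (ML2 R1 ∧ ML2 R2 ∧ ML2 R3 ∧ ML2 R4) →
      -- equation (E1), first and second components
      (∀ y, 0 < y →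
        Complex.I * (((n:ℝ)/ϱ : ℝ) : ℂ) *
            ((((1 + μ/κ) * Us (y / Real.sqrt ε) : ℝ) : ℂ) * u y
              - ((Hs (y / Real.sqrt ε) ^ 2 - Us (y / Real.sqrt ε) ^ 2 : ℝ) : ℂ) * h y
              + ((Real.sqrt ε : ℝ) : ℂ) *
                  (AU (y / Real.sqrt ε) 0 0 * h y + AU (y / Real.sqrt ε) 0 1 * g y))
          + ((Real.sqrt ε : ℝ) : ℂ) *
              (BU (y / Real.sqrt ε) 0 0 * deriv h y + BU (y / Real.sqrt ε) 0 1 * deriv g y)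
          + (CU (y / Real.sqrt ε) 0 0 * h y + CU (y / Real.sqrt ε) 0 1 * g y)
          + (((Real.sqrt ε)⁻¹ : ℝ) : ℂ) * (∫ s in (0:ℝ)..y, h s) * DU (y / Real.sqrt ε) 0
          + Complex.I * (((n:ℝ)/ϱ : ℝ) : ℂ) * p y
          - ((μ * ε : ℝ) : ℂ) *
              (deriv (deriv u) y - (((n:ℝ)/ϱ : ℝ) : ℂ)^2 * u y)
          = R1 y) →
      (∀ y, 0 < y →
        Complex.I * (((n:ℝ)/ϱ : ℝ) : ℂ) *
            ((((1 + μ/κ) * Us (y / Real.sqrt ε) : ℝ) : ℂ) * v y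
              - ((Hs (y / Real.sqrt ε) ^ 2 - Us (y / Real.sqrt ε) ^ 2 : ℝ) : ℂ) * g y
              + ((Real.sqrt ε : ℝ) : ℂ) *
                  (AU (y / Real.sqrt ε) 1 0 * h y + AU (y / Real.sqrt ε) 1 1 * g y))
          + ((Real.sqrt ε : ℝ) : ℂ) *
              (BU (y / Real.sqrt ε) 1 0 * deriv h y + BU (y / Real.sqrt ε) 1 1 * deriv g y)
          + (CU (y / Real.sqrt ε) 1 0 * h y + CU (y / Real.sqrt ε) 1 1 * g y)
          + (((Real.sqrt ε)⁻¹ : ℝ) : ℂ) * (∫ s in (0:ℝ)..y, h s) * DU (y / Real.sqrt ε) 1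
          + deriv p y
          - ((μ * ε : ℝ) : ℂ) *
              (deriv (deriv v) y - (((n:ℝ)/ϱ : ℝ) : ℂ)^2 * v y)
          = R2 y) →
      -- equation (E2), first and second components
      (∀ y, 0 < y →
        -(Complex.I * (((n:ℝ)/ϱ : ℝ) : ℂ)) * u y
          - ((2 * κ * Real.sqrt ε *
              (deriv Hs (y / Real.sqrt ε) / Hs (y / Real.sqrt ε)) : ℝ) : ℂ) * deriv h y
          + (CH (y / Real.sqrt ε) 0 0 * h y + CH (y / Real.sqrt ε) 0 1 * g y)
          + (((Real.sqrt ε)⁻¹ : ℝ) : ℂ) * (∫ s in (0:ℝ)..y, h s) * DH (y / Real.sqrt ε) 0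
          - ((κ * ε : ℝ) : ℂ) *
              (deriv (deriv h) y - (((n:ℝ)/ϱ : ℝ) : ℂ)^2 * h y)
          = R3 y) →
      (∀ y, 0 < y →
        -(Complex.I * (((n:ℝ)/ϱ : ℝ) : ℂ)) * v y
          - ((2 * κ * Real.sqrt ε *
              (deriv Hs (y / Real.sqrt ε) / Hs (y / Real.sqrt ε)) : ℝ) : ℂ) * deriv g y
          + (CH (y / Real.sqrt ε) 1 0 * h y + CH (y / Real.sqrt ε) 1 1 * g y)
          + (((Real.sqrt ε)⁻¹ : ℝ) : ℂ) * (∫ s in (0:ℝ)..y, h s) * DH (y / Real.sqrt ε) 1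
          - ((κ * ε : ℝ) : ℂ) *
              (deriv (deriv g) y - (((n:ℝ)/ϱ : ℝ) : ℂ)^2 * g y)
          = R4 y) →
      -- equation (E3): divergence-free conditions
      (∀ y, 0 < y →
        Complex.I * (((n:ℝ)/ϱ : ℝ) : ℂ) * u y + deriv v y = 0 ∧
        Complex.I * (((n:ℝ)/ϱ : ℝ) : ℂ) * h y + deriv g y = 0) →
      -- equation (E4): boundary conditions
      u 0 = 0 → v 0 = 0 → deriv h 0 = 0 → g 0 = 0 →
      Real.sqrt ε *
          (nrm4 (wt Z (deriv u)) (wt Z (deriv v)) (wt Z (deriv h)) (wt Z (deriv g))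
            + |(n:ℝ)/ϱ| * nrm4 (wt Z u) (wt Z v) (wt Z h) (wt Z g))
        ≤ C * |Real.log ε| ^ ((1:ℝ)/2 + η/6) *
              ((Real.sqrt |(n:ℝ)/ϱ|)⁻¹ * nrm4 (wt Z R1) (wt Z R2) (wt Z R3) (wt Z R4)
                + Real.sqrt |(n:ℝ)/ϱ| * nrm4 (wt Z u) (wt Z v) (wt Z h) (wt Z g))
          + C * ε ^ ((1:ℝ)/4) *
              (nrm4 u v h g
                + Real.sqrt (nrm4 u v h g) * Real.sqrt (nrm4 R1 R2 R3 R4)) := by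
  intro η hη ϱ hϱ Mbar
  obtain ⟨M, hMdef⟩ : ∃ M : ℝ, M = |Mbar| := ⟨_, rfl⟩
  have hM0 : 0 ≤ M := by rw [hMdef]; exact abs_nonneg _
  have hγb : 0 < γbar := hγ.trans_le hγγ
  obtain ⟨Ka, hKa⟩ : ∃ Ka : ℝ, Ka = M + M * (1 + M) + 2 * κ * (M / γ) := ⟨_, rfl⟩
  have hKa0 : 0 ≤ Ka := by rw [hKa]; positivity
  have hKa1 : M ≤ Ka := by
    have : 0 ≤ M * (1 + M) := by positivity
    have : 0 ≤ 2 * κ * (M / γ) := by positivity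
    linarith
  have hKa2 : M * (1 + M) ≤ Ka := by
    have : 0 ≤ 2 * κ * (M / γ) := by positivity
    linarith
  have hKa3 : 2 * κ * (M / γ) ≤ Ka := by
    have : 0 ≤ M * (1 + M) := by positivity
    linarith
  obtain ⟨K, hKdef⟩ : ∃ K : ℝ, K = 1 + C₀ + C₀ * (M + 1) + γbar ^ 2 + (1 + μ / κ) * γbar
    + 2 * γbar * M + 2 * Ka := ⟨_, rfl⟩
  have p1 : 0 ≤ C₀ * (M + 1) := by positivity
  have p2 : 0 ≤ γbar ^ 2 := by positivity
  have p3 : 0 ≤ (1 + μ / κ) * γbar := by positivity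
  have p4 : 0 ≤ 2 * γbar * M := by positivity
  have hK : 1 ≤ K := by linarith
  have hK0 : 0 < K := by linarith
  have hKC : C₀ ≤ K := by linarith
  have hKC2 : C₀ * (M + 1) ≤ K := by linarith
  have hKγ : γbar ^ 2 ≤ K := by linarith
  have hKc : (1 + μ / κ) * γbar ≤ K := by linarith
  have hKG : 2 * γbar * M ≤ K := by linarith
  have hKKa : 2 * Ka ≤ K := by linarith
  refine ⟨Real.exp (-1), Real.sqrt (2 * Cfin μ κ γ₀ K / min μ (κ * γ₀)), Real.exp_pos _, ?_, ?_⟩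
  · have hc1 : 0 < min μ (κ * γ₀) := lt_min hμ (mul_pos hκ hγ₀)
    have hCJ : 0 ≤ CJ μ κ γ₀ K := by unfold CJ; positivity
    have hCf : 0 < Cfin μ κ γ₀ K := by unfold Cfin; positivity
    positivity
  intro ε n hε hε1 hn Us Hs cU cH _ bH bG bUH AU BU CU CH DU DH cA cB cC cCH cD cDH bAB bC bD
    Z cZ hZ hZ2 hZc _ _ _ _ hZd u v h g p R1 R2 R3 R4 cu cv ch cg cp mW mW1 _ lW lW1 _ lp mR
    e1 e2 e3 e4 hdiv u0 v0 h10 g0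
  replace hε : 0 < ε := hε.1
  obtain ⟨s, hs⟩ : ∃ s : ℝ, s = Real.sqrt ε := ⟨_, rfl⟩
  have hs0 : 0 < s := by rw [hs]; exact Real.sqrt_pos.2 hε
  have hMM : Mbar = M := by
    have h0 := bAB 0 le_rfl 0 0
    have : 0 ≤ Mbar := le_trans (by positivity) h0
    rw [hMdef, abs_of_nonneg this]
  rw [hMM] at bUH bAB bC bD hZd
  obtain ⟨N, hN⟩ : ∃ N : ℝ, N = (n:ℝ) / ϱ := ⟨_, rfl⟩
  have hN0 : N ≠ 0 := by rw [hN]; exact div_ne_zero (by exact_mod_cast hn) hϱ.ne'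
  rw [← hN]
  simp only [← hN, ← hs] at e1 e2 e3 e4 hdiv
  -- profile bounds
  have hY : ∀ y : ℝ, 0 ≤ y → 0 ≤ y / s := fun y hy => div_nonneg hy hs0.le
  have bU : ∀ Y, 0 ≤ Y → |Us Y| ≤ γbar := fun Y hY => by
    have a1 := bG Y hY
    have a2 := (bH Y hY).2
    have : |Us Y| ≤ |Hs Y| := sq_le_sq.1 (by linarith)
    linarith
  have dU : ∀ Y, HasDerivAt Us (deriv Us Y) Y := fun Y =>
    (cU.differentiable (by norm_num) Y).hasDerivAt
  have dH : ∀ Y, HasDerivAt Hs (deriv Hs Y) Y := fun Y =>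
    (cH.differentiable (by norm_num) Y).hasDerivAt
  have bd : ∀ Y, 0 ≤ Y → (1 + Y) * (|deriv Us Y| + |deriv Hs Y|) ≤ M := fun Y hY => by
    have := bUH Y hY 1 le_rfl (by norm_num)
    rw [iteratedDeriv_one, iteratedDeriv_one] at this
    refine le_trans ?_ this
    gcongr
    have : 1 ≤ 1 + Y := by linarith
    exact le_self_pow₀ this (by norm_num)
  have hder : ∀ {f : ℝ → ℂ}, ContDiff ℝ 3 f → (∀ y, HasDerivAt f (deriv f y) y) ∧
      (∀ y, HasDerivAt (deriv f) (deriv (deriv f) y) y) ∧ Continuous (deriv (deriv f)) := by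
    intro f hf
    have h3 : ContDiff ℝ (2 + 1) f := by convert hf using 1; norm_num
    have h2 : ContDiff ℝ 2 (deriv f) := (contDiff_succ_iff_deriv.1 h3).2.2
    have h2' : ContDiff ℝ (1 + 1) (deriv f) := by convert h2 using 1; norm_num
    have h1 : ContDiff ℝ 1 (deriv (deriv f)) := (contDiff_succ_iff_deriv.1 h2').2.2
    exact ⟨fun y => (hf.differentiable (by norm_num) y).hasDerivAt,
      fun y => (h2.differentiable (by norm_num) y).hasDerivAt, h1.continuous⟩
  have hpos : ∀ᵐ y ∂(volume.restrict (Ioi (0:ℝ))), 0 < y := ae_restrict_mem measurableSet_Ioi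
  obtain ⟨du, du1, cu2⟩ := hder cu
  obtain ⟨dv, dv1, cv2⟩ := hder cv
  obtain ⟨dh, dh1, ch2⟩ := hder ch
  obtain ⟨dg, dg1, cg2⟩ := hder cg
  have cont : ∀ {f f' : ℝ → ℂ}, (∀ y, HasDerivAt f (f' y) y) → Continuous f := fun hd =>
    continuous_iff_continuousAt.2 fun y => (hd y).continuousAt
  have cu0 := cont du
  have cv0 := cont dv
  have ch0 := cont dh
  have cg0 := cont dg
  have cu1 := cont du1
  have cv1 := cont dv1
  have ch1 := cont dh1
  have cg1 := cont dg1
  have dp : ∀ y, HasDerivAt p (deriv p y) y := fun y =>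
    (cp.differentiable (by norm_num) y).hasDerivAt
  have cp0 := cont dp
  have cp1 : Continuous (deriv p) := cp.continuous_deriv (by norm_num)
  -- the stream function
  obtain ⟨ψ, hψ⟩ : ∃ ψ : ℝ → ℂ, ψ = fun y => ∫ t in (0:ℝ)..y, h t := ⟨_, rfl⟩
  have dψ : ∀ y, HasDerivAt ψ (h y) y := fun y => by
    rw [hψ]; exact (ch0.integral_hasStrictDerivAt 0 y).hasDerivAt
  have ψ0 : ψ 0 = 0 := by rw [hψ]; simp
  have cψ := cont dψ
  have hψy : ∀ y, (∫ t in (0:ℝ)..y, h t) = ψ y := fun y => by rw [hψ]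
  simp only [hψy] at e1 e2 e3 e4
  obtain ⟨hq1, hq2⟩ := hardy dψ ch0 ψ0 mW.2.2.1
  have cq : Continuous (fun y => ‖dslope ψ 0 y‖) := (dslope_cont dψ).norm
  have hqy : ∀ y, 0 < y → ‖ψ y‖ = y * ‖dslope ψ 0 y‖ := fun y hy => by
    rw [dslope_zero_norm ψ0 hy]; field_simp
  -- measurability of the data
  have mds : Measurable (fun y : ℝ => y / s) := by fun_prop
  have mMat : ∀ {A : ℝ → Matrix (Fin 2) (Fin 2) ℂ}, Continuous A → ∀ i j,
      Measurable (fun y : ℝ => A (y / s) i j) := fun {A} hA i j => by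
    have : Continuous (fun Y => A Y i j) := by fun_prop
    exact this.measurable.comp mds
  have mVec : ∀ {A : ℝ → Fin 2 → ℂ}, Continuous A → ∀ i,
      Measurable (fun y : ℝ => A (y / s) i) := fun {A} hA i => by
    have : Continuous (fun Y => A Y i) := by fun_prop
    exact this.measurable.comp mds
  have mUs : Measurable (fun y : ℝ => Us (y / s)) := cU.continuous.measurable.comp mds
  have mHs : Measurable (fun y : ℝ => Hs (y / s)) := cH.continuous.measurable.comp mds
  have mHd : Measurable (fun y : ℝ => deriv Hs (y / s)) :=
    (cH.continuous_deriv (by norm_num)).measurable.comp mds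
  have mA := mMat cA
  have mB := mMat cB
  have mC := mMat cC
  have mCH := mMat cCH
  have mD := mVec cD
  have mDH := mVec cDH
  have mu0 := cu0.measurable
  have mv0 := cv0.measurable
  have mh0 := ch0.measurable
  have mg0 := cg0.measurable
  have mh1 := ch1.measurable
  have mg1 := cg1.measurable
  have mu2 := cu2.measurable
  have mv2 := cv2.measurable
  have mh2 := ch2.measurable
  have mg2 := cg2.measurable
  have mp0 := cp0.measurable
  have mp1 := cp1.measurable
  have mψ := cψ.measurable
  have asm : ∀ {F R : ℝ → ℂ}, Measurable F → (∀ y, 0 < y → F y = R y) →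
      AEStronglyMeasurable R (volume.restrict (Ioi 0)) := fun hF hFR => by
    refine hF.aestronglyMeasurable.congr ?_
    filter_upwards [hpos] with y hy using hFR y hy
  have mcc : Measurable (fun y : ℝ => (1 + μ/κ) * Us (y / s)) := mUs.const_mul _
  have mGG : Measurable (fun y : ℝ => Hs (y / s) ^ 2 - Us (y / s) ^ 2) :=
    (mHs.pow_const 2).sub (mUs.pow_const 2)
  have mbp : Measurable (fun y : ℝ => 2 * κ * s * (deriv Hs (y / s) / Hs (y / s))) :=
    (mHd.div mHs).const_mul _
  have mR1 : AEStronglyMeasurable R1 (volume.restrict (Ioi 0)) :=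
    asm (meas1 mcc mGG (mA 0 0) (mA 0 1) (mB 0 0) (mB 0 1) (mC 0 0) (mC 0 1) (mD 0) mψ mu0 mh0
      mh0 mg0 mh1 mg1 (mp0.const_mul _) mu2) e1
  have mR2 : AEStronglyMeasurable R2 (volume.restrict (Ioi 0)) :=
    asm (meas1 mcc mGG (mA 1 0) (mA 1 1) (mB 1 0) (mB 1 1) (mC 1 0) (mC 1 1) (mD 1) mψ mv0 mg0
      mh0 mg0 mh1 mg1 mp1 mv2) e2
  have mR3 : AEStronglyMeasurable R3 (volume.restrict (Ioi 0)) :=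
    asm (meas2 mbp (mCH 0 0) (mCH 0 1) (mDH 0) mψ mu0 mh0 mh0 mg0 mh1 mh2) e3
  have mR4 : AEStronglyMeasurable R4 (volume.restrict (Ioi 0)) :=
    asm (meas2 mbp (mCH 1 0) (mCH 1 1) (mDH 1) mψ mv0 mg0 mh0 mg0 mg1 mg2) e4
  -- coefficient bounds
  have tA : ∀ y, 0 < y → ∀ i j, (1 + y / s) * ‖AU (y / s) i j‖ ≤ Ka := fun y hy i j => by
    have h1 := hY y hy.le
    refine le_trans ?_ ((bAB _ h1 i j).trans hKa1)
    gcongr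
    exact le_add_of_nonneg_right (norm_nonneg _)
  have tB : ∀ y, 0 < y → ∀ i j, (1 + y / s) * ‖BU (y / s) i j‖ ≤ Ka := fun y hy i j => by
    have h1 := hY y hy.le
    refine le_trans ?_ ((bAB _ h1 i j).trans hKa1)
    gcongr
    exact le_add_of_nonneg_left (norm_nonneg _)
  have tC : ∀ y, 0 < y → ∀ i j, (1 + y / s) * ‖CU (y / s) i j‖ ≤ Ka := fun y hy i j => by
    have h1 := hY y hy.le
    refine le_trans ?_ ((bC _ h1 i j).trans hKa2)
    gcongr
    exact le_add_of_nonneg_right (norm_nonneg _)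
  have tCH : ∀ y, 0 < y → ∀ i j, (1 + y / s) * ‖CH (y / s) i j‖ ≤ Ka := fun y hy i j => by
    have h1 := hY y hy.le
    refine le_trans ?_ ((bC _ h1 i j).trans hKa2)
    gcongr
    exact le_add_of_nonneg_left (norm_nonneg _)
  have tD : ∀ y, 0 < y → ∀ i, (1 + y / s) ^ 2 * ‖DU (y / s) i‖ ≤ Ka := fun y hy i => by
    have h1 := hY y hy.le
    refine le_trans ?_ ((bD _ h1 i).trans hKa2)
    gcongr
    exact le_add_of_nonneg_right (norm_nonneg _)
  have tDH : ∀ y, 0 < y → ∀ i, (1 + y / s) ^ 2 * ‖DH (y / s) i‖ ≤ Ka := fun y hy i => by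
    have h1 := hY y hy.le
    refine le_trans ?_ ((bD _ h1 i).trans hKa2)
    gcongr
    exact le_add_of_nonneg_left (norm_nonneg _)
  have tP : ∀ y, 0 < y → (1 + y / s) *
      ‖((-(2 * κ * (deriv Hs (y / s) / Hs (y / s))) : ℝ) : ℂ)‖ ≤ Ka := fun y hy => by
    have h1 := hY y hy.le
    have h2 := bd _ h1
    have h3 := (bH _ h1).1
    refine le_trans ?_ hKa3
    rw [Complex.norm_real, Real.norm_eq_abs, abs_neg, abs_mul, abs_div,
      abs_of_pos (show 0 < 2 * κ by positivity)]
    calc (1 + y / s) * (2 * κ * (|deriv Hs (y / s)| / |Hs (y / s)|))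
        = 2 * κ * ((1 + y / s) * |deriv Hs (y / s)| / |Hs (y / s)|) := by ring
      _ ≤ 2 * κ * (M / γ) := by
        gcongr
        refine le_trans ?_ h2
        gcongr
        exact le_add_of_nonneg_left (abs_nonneg _)
  have t0 : ∀ y, 0 < y → (1 + y / s) * ‖(0:ℂ)‖ ≤ Ka := fun y _ => by simpa using hKa0
  have haN : ‖Complex.I * (N:ℂ) * (s:ℂ)‖ ≤ s * |N| := by
    rw [norm_mul, norm_mul, Complex.norm_I, Complex.norm_real, Complex.norm_real,
      Real.norm_eq_abs, Real.norm_of_nonneg hs0.le]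
    exact le_of_eq (by ring)
  have haN0 : ‖(0:ℂ)‖ ≤ s * |N| := by rw [norm_zero]; positivity
  -- the reduced system
  have core : Core μ κ γ₀ K ε N (fun y => (1 + μ/κ) * Us (y / s))
      (fun y => Hs (y / s) ^ 2 - Us (y / s) ^ 2)
      (fun y => 2 * Hs (y / s) * (deriv Hs (y / s) / s) - 2 * Us (y / s) * (deriv Us (y / s) / s))
      (fun y => 2 * Ka * ((s * |N| + 1) * w4 u v h g y
        + s * w4 (deriv u) (deriv v) (deriv h) (deriv g) y + ‖dslope ψ 0 y‖) / (1 + y / s))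
      (fun y => ‖dslope ψ 0 y‖) u v h g (deriv u) (deriv v) (deriv h) (deriv g)
      (deriv (deriv u)) (deriv (deriv v)) (deriv (deriv h)) (deriv (deriv g)) p (deriv p)
      (fun y => Complex.I * (N:ℂ) * (s:ℂ) * (AU (y / s) 0 0 * h y + AU (y / s) 0 1 * g y)
        + (s:ℂ) * (BU (y / s) 0 0 * deriv h y + BU (y / s) 0 1 * deriv g y)
        + (CU (y / s) 0 0 * h y + CU (y / s) 0 1 * g y)
        + ((s⁻¹ : ℝ):ℂ) * ψ y * DU (y / s) 0)
      (fun y => Complex.I * (N:ℂ) * (s:ℂ) * (AU (y / s) 1 0 * h y + AU (y / s) 1 1 * g y)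
        + (s:ℂ) * (BU (y / s) 1 0 * deriv h y + BU (y / s) 1 1 * deriv g y)
        + (CU (y / s) 1 0 * h y + CU (y / s) 1 1 * g y)
        + ((s⁻¹ : ℝ):ℂ) * ψ y * DU (y / s) 1)
      (fun y => 0 * (0 * h y + 0 * g y)
        + (s:ℂ) * (((-(2 * κ * (deriv Hs (y / s) / Hs (y / s))) : ℝ) : ℂ) * deriv h y
          + 0 * deriv g y)
        + (CH (y / s) 0 0 * h y + CH (y / s) 0 1 * g y)
        + ((s⁻¹ : ℝ):ℂ) * ψ y * DH (y / s) 0)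
      (fun y => 0 * (0 * h y + 0 * g y)
        + (s:ℂ) * (0 * deriv h y
          + ((-(2 * κ * (deriv Hs (y / s) / Hs (y / s))) : ℝ) : ℂ) * deriv g y)
        + (CH (y / s) 1 0 * h y + CH (y / s) 1 1 * g y)
        + ((s⁻¹ : ℝ):ℂ) * ψ y * DH (y / s) 1)
      R1 R2 R3 R4 := by
    have mpos : ∀ y, 0 ≤ (s * |N| + 1) * w4 u v h g y
        + s * w4 (deriv u) (deriv v) (deriv h) (deriv g) y + ‖dslope ψ 0 y‖ := fun y => by
      have a := w4_nonneg u v h g y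
      have b := w4_nonneg (deriv u) (deriv v) (deriv h) (deriv g) y
      positivity
    have bGd : ∀ y, 0 < y → |2 * Hs (y / s) * (deriv Hs (y / s) / s)
        - 2 * Us (y / s) * (deriv Us (y / s) / s)| * (s * (1 + y / s)) ≤ K := fun y hy => by
      have h1 := hY y hy.le
      have h2 := bd _ h1
      have e : 2 * Hs (y / s) * (deriv Hs (y / s) / s) - 2 * Us (y / s) * (deriv Us (y / s) / s) =
        (2 * Hs (y / s) * deriv Hs (y / s) - 2 * Us (y / s) * deriv Us (y / s)) / s := by ring
      rw [e, abs_div, abs_of_pos hs0]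
      have a1 : |2 * Hs (y / s) * deriv Hs (y / s) - 2 * Us (y / s) * deriv Us (y / s)| ≤
          2 * γbar * (|deriv Us (y / s)| + |deriv Hs (y / s)|) := by
        refine (abs_sub _ _).trans ?_
        rw [abs_mul, abs_mul, abs_mul, abs_mul, abs_two]
        have b1 := mul_le_mul_of_nonneg_right (bH _ h1).2 (abs_nonneg (deriv Hs (y / s)))
        have b2 := mul_le_mul_of_nonneg_right (bU _ h1) (abs_nonneg (deriv Us (y / s)))
        linarith
      calc _ = |2 * Hs (y / s) * deriv Hs (y / s) - 2 * Us (y / s) * deriv Us (y / s)|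
            * (1 + y / s) := by field_simp
        _ ≤ 2 * γbar * (|deriv Us (y / s)| + |deriv Hs (y / s)|) * (1 + y / s) := by gcongr
        _ = 2 * γbar * ((1 + y / s) * (|deriv Us (y / s)| + |deriv Hs (y / s)|)) := by ring
        _ ≤ 2 * γbar * M := by gcongr
        _ ≤ K := hKG
    refine
      { hμ := hμ, hκ := hκ, hγ₀ := hγ₀, hK := hK, hε := hε, hn := hN0, du := du, dv := dv,
        dh := dh, dg := dg, du1 := du1, dv1 := dv1, dh1 := dh1, dg1 := dg1, dp := dp,
        dG := ?_, bcu := ?_, bG := ?_, bG1 := ?_, bE := ?_, be := ?_, be' := ?_,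
        e1 := ?_, e2 := ?_, e3 := ?_, e4 := ?_, d := fun y hy => (hdiv y hy).1, u0 := u0, v0 := v0,
        h10 := h10, g0 := g0, lW := lW, lW1 := lW1, lp := lp,
        mW := ?_, mW1 := ?_, mR := ?_, mq := ?_, q0 := fun y => norm_nonneg _, qle := ?_ }
    · intro y
      have dd : HasDerivAt (fun y : ℝ => y / s) (1 / s) y := (hasDerivAt_id y).div_const s
      have d1 := ((dH (y / s)).comp y dd).pow 2
      have d2 := ((dU (y / s)).comp y dd).pow 2
      refine HasDerivAt.congr_deriv (d1.sub d2) ?_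
      simp only [Function.comp_apply]
      push_cast
      ring
    · intro y hy
      have h1 := bU _ (hY y hy.le)
      rw [abs_mul, abs_of_pos (show 0 < 1 + μ / κ by positivity)]
      refine le_trans ?_ hKc
      gcongr
    · intro y hy
      refine ⟨bG _ (hY y hy), le_trans ?_ hKγ⟩
      have h1 := (bH _ (hY y hy)).2
      have h2 : Hs (y / s) ^ 2 ≤ γbar ^ 2 := by
        rw [← sq_abs]; gcongr
      have := sq_nonneg (Us (y / s))
      linarith
    · intro y hy
      have h0 := bGd y hy
      have h1 := hY y hy.le
      rw [← hs]
      constructor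
      · refine le_trans ?_ h0
        gcongr
        nlinarith
      · refine le_trans ?_ h0
        rw [mul_comm]
        gcongr
        have : s * (1 + y / s) = s + y := by field_simp
        linarith
    · intro y hy
      obtain ⟨-, -, wh, wg⟩ := le_w4 u v h g y
      obtain ⟨-, -, wh1, wg1⟩ := le_w4 (deriv u) (deriv v) (deriv h) (deriv g) y
      have hq := norm_nonneg (dslope ψ 0 y)
      exact ⟨term_bd hs0 (abs_nonneg N) hy rfl hKa0 haN (tA y hy 0 0) (tA y hy 0 1)
          (tB y hy 0 0) (tB y hy 0 1) (tC y hy 0 0) (tC y hy 0 1) (tD y hy 0)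
          wh wg wh1 wg1 (hqy y hy) hq,
        term_bd hs0 (abs_nonneg N) hy rfl hKa0 haN (tA y hy 1 0) (tA y hy 1 1)
          (tB y hy 1 0) (tB y hy 1 1) (tC y hy 1 0) (tC y hy 1 1) (tD y hy 1)
          wh wg wh1 wg1 (hqy y hy) hq,
        term_bd hs0 (abs_nonneg N) hy rfl hKa0 haN0 (t0 y hy) (t0 y hy)
          (tP y hy) (t0 y hy) (tCH y hy 0 0) (tCH y hy 0 1) (tDH y hy 0)
          wh wg wh1 wg1 (hqy y hy) hq,
        term_bd hs0 (abs_nonneg N) hy rfl hKa0 haN0 (t0 y hy) (t0 y hy)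
          (t0 y hy) (tP y hy) (tCH y hy 1 0) (tCH y hy 1 1) (tDH y hy 1)
          wh wg wh1 wg1 (hqy y hy) hq⟩
    · intro y hy
      rw [← hs]
      have h1 := hY y hy.le
      have h2 := mpos y
      refine (div_le_self (by positivity) (by linarith)).trans ?_
      gcongr
    · intro y hy
      rw [← hs]
      have h1 := hY y hy.le
      have h2 := mpos y
      set m := (s * |N| + 1) * w4 u v h g y
        + s * w4 (deriv u) (deriv v) (deriv h) (deriv g) y + ‖dslope ψ 0 y‖
      have h3 : y / (1 + y / s) ≤ s := by
        rw [div_le_iff₀ (by positivity)]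
        have : s * (1 + y / s) = s + y := by field_simp
        linarith
      calc y * (2 * Ka * m / (1 + y / s)) = 2 * Ka * (y / (1 + y / s)) * m := by ring
        _ ≤ K * s * m := by gcongr
    · intro y hy
      rw [← e1 y hy]; push_cast; ring
    · intro y hy
      rw [← e2 y hy]; push_cast; ring
    · intro y hy
      rw [← e3 y hy]; push_cast; ring
    · intro y hy
      rw [← e4 y hy]; push_cast; ring
    · exact w4_mem mW.1 mW.2.1 mW.2.2.1 mW.2.2.2 cu0.aestronglyMeasurable
        cv0.aestronglyMeasurable ch0.aestronglyMeasurable cg0.aestronglyMeasurable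
    · exact w4_mem mW1.1 mW1.2.1 mW1.2.2.1 mW1.2.2.2 cu1.aestronglyMeasurable
        cv1.aestronglyMeasurable ch1.aestronglyMeasurable cg1.aestronglyMeasurable
    · exact w4_mem mR.1 mR.2.1 mR.2.2.1 mR.2.2.2 mR1 mR2 mR3 mR4
    · rw [memLp_two_iff_integrable_sq cq.aestronglyMeasurable]
      exact hq1
    · refine hq2.trans ?_
      have mem := w4_mem mW.1 mW.2.1 mW.2.2.1 mW.2.2.2 cu0.aestronglyMeasurable
        cv0.aestronglyMeasurable ch0.aestronglyMeasurable cg0.aestronglyMeasurable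
      gcongr
      refine integral_mono mW.2.2.1 mem.integrable_sq fun y => ?_
      exact pow_le_pow_left₀ (norm_nonneg _) (le_w4 u v h g y).2.2.1 2
  -- the weight
  have dZ : ∀ y, HasDerivAt Z (deriv Z y) y := fun y =>
    (cZ.differentiable (by norm_num) y).hasDerivAt
  have cZ1 : ContDiff ℝ 1 (deriv Z) := by
    have h2' : ContDiff ℝ (1 + 1) Z := by convert cZ using 1; norm_num
    exact (contDiff_succ_iff_deriv.1 h2').2.2
  have dZ1 : ∀ y, HasDerivAt (deriv Z) (deriv (deriv Z) y) y := fun y =>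
    (cZ1.differentiable (by norm_num) y).hasDerivAt
  have Z0 : ∀ y, 0 ≤ y → 0 ≤ Z y ∧ Z y ≤ K := fun y hy =>
    ⟨(hZ y hy).1, (hZ y hy).2.1.trans hKC⟩
  have fin := core.final hε1 hη dZ dZ1 Z0
    (fun y hy => by
      rcases le_total y 2 with h2 | h2
      · refine (hZ2 y ⟨hy, h2⟩).2.trans ?_
        gcongr
      · have := (hZ y hy).2.1
        nlinarith)
    (fun y hy h2 => by
      have h3 := (hZ2 y ⟨hy.le, h2⟩).1
      have hC : 0 < C₀ := by linarith
      rw [inv_mul_le_iff₀ hC] at h3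
      have h4 := (Z0 y hy.le).1
      refine h3.trans ?_
      gcongr)
    (fun y hy => by
      have h3 := (hZd y hy).1
      have h4 := abs_nonneg (deriv Z y)
      nlinarith)
    (fun y hy => by
      have : Z =ᶠ[nhds y] fun _ => Z 2 := by
        filter_upwards [Ioi_mem_nhds hy] with t ht using hZc t (le_of_lt ht)
      rw [this.deriv_eq]; simp)
    (fun y hy => (hZd y hy).2.trans hKC2)
  have Zc : Continuous Z := cZ.continuous
  rw [nrm4_wt Zc Z0 mW1.1 mW1.2.1 mW1.2.2.1 mW1.2.2.2,
    nrm4_wt Zc Z0 mW.1 mW.2.1 mW.2.2.1 mW.2.2.2,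
    nrm4_wt Zc Z0 mR.1 mR.2.1 mR.2.2.1 mR.2.2.2,
    nrm4_eq mW.1 mW.2.1 mW.2.2.1 mW.2.2.2, nrm4_eq mR.1 mR.2.1 mR.2.2.1 mR.2.2.2]
  exact fin
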